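/- arXiv:2503.08590 — 4 statements merged into one kernel-verified Lean document; each statement's English description precedes it below -/
import Mathlib

section
/- The Toeplitz operator T_a with symbol a has trivial kernel on H¹: if f : ℝ → ℂ is 2π-periodic and integrable on [0,2π], its Fourier coefficients satisfy f̂(n) = 0 for all integers n < 0, and the product a·f (which is integrable, a being essentially bounded) satisfies (a·f)^(n) = 0 for all integers n ≥ 0, then f = 0 almost everywhere. -/
open MeasureTheory intervalIntegral Real

/-- The symbol `a(θ) = (1 - Log(1+e^{iθ}))/(1 - Log(1+e^{-iθ}))` in the parametrization
`z = e^{iθ}` of the unit circle. -/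
noncomputable def toeplitzSymbol (θ : ℝ) : ℂ :=
  (1 - Complex.log (1 + Complex.exp ((θ : ℂ) * Complex.I))) /
    (1 - Complex.log (1 + Complex.exp (-(θ : ℂ) * Complex.I)))

/-- The function
`(1 + z) (1 - Log (1 + z))` is the sum of an absolutely convergent power series on the closed
unit disc. -/
theorem exists_summable_hasSum_one_add_mul_one_sub_log :
    ∃ c : ℕ → ℂ, Summable (fun n => ‖c n‖) ∧ ∀ z : ℂ, ‖z‖ ≤ 1 → 0 < (1 + z).re →
      HasSum (fun n => c n * z ^ n) ((1 + z) * (1 - Complex.log (1 + z))) := by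
  set b : ℕ → ℂ := fun n => (-1) ^ (n + 1) / n with hb
  set c : ℕ → ℂ := fun n => Nat.casesOn n 1 fun n => (if n = 0 then 1 else 0) - (b (n + 1) + b n)
    with hc
  have hsum : Summable (fun n => ‖c n‖) := by
    rw [← summable_nat_add_iff 2]
    refine Summable.of_nonneg_of_le (fun _ => norm_nonneg _) (fun n => ?_)
      ((summable_nat_add_iff 1).2 (Real.summable_one_div_nat_pow.2 one_lt_two))
    have h1 : ((n : ℂ) + 1) ≠ 0 := by exact_mod_cast Nat.succ_ne_zero n
    have h2 : ((n : ℂ) + 1 + 1) ≠ 0 := by exact_mod_cast Nat.succ_ne_zero (n + 1)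
    have h3 : c (n + 2) = (-1) ^ n * (-1) * (1 / (((n + 1 : ℕ) : ℂ) * ((n + 2 : ℕ) : ℂ))) := by
      simp only [hc, hb]
      push_cast
      rw [show (n : ℂ) + 2 = n + 1 + 1 by ring]
      field_simp
      simp
      ring
    rw [h3]
    simp only [norm_mul, norm_pow, norm_neg, norm_one, one_pow, one_mul, norm_div,
      Complex.norm_natCast]
    push_cast
    rw [sq]
    gcongr
    linarith
  have hdisc : ∀ z : ℂ, ‖z‖ < 1 →
      HasSum (fun n => c n * z ^ n) ((1 + z) * (1 - Complex.log (1 + z))) := by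
    intro z hz
    have hlog := Complex.hasSum_taylorSeries_log hz
    have hb' : HasSum (fun n => b n * z ^ n) (Complex.log (1 + z)) := by
      simpa only [hb, div_mul_eq_mul_div] using hlog
    have hlog' : HasSum (fun n => b (n + 1) * z ^ (n + 1)) (Complex.log (1 + z)) := by
      simpa [hb] using (hasSum_nat_add_iff' 1).2 hb'
    have hmul : HasSum (fun n => b n * z ^ (n + 1)) (Complex.log (1 + z) * z) := by
      simpa only [pow_succ, mul_assoc] using hb'.mul_right z
    have hone : HasSum (fun n : ℕ => (if n = 0 then (1 : ℂ) else 0) * z ^ (n + 1)) z := by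
      convert! hasSum_single 0 fun n (hn : n ≠ 0) => ?_
      · simp
      · simp [hn]
    rw [← hasSum_nat_add_iff' 1]
    convert! hone.sub (hlog'.add hmul) using 1
    · ext n
      simp only [hc]
      ring
    · simp [hc]
      ring
  refine ⟨c, hsum, fun z hz hre => ?_⟩
  have hterm : ∀ w ∈ Metric.closedBall (0 : ℂ) 1, ∀ n, ‖c n * w ^ n‖ ≤ ‖c n‖ := by
    intro w hw n
    rw [norm_mul, norm_pow]
    exact mul_le_of_le_one_right (norm_nonneg _)
      (pow_le_one₀ (norm_nonneg _) (by simpa using hw))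
  have hcont : ContinuousOn (fun w : ℂ => ∑' n, c n * w ^ n) (Metric.closedBall 0 1) :=
    continuousOn_tsum (fun n => by fun_prop) hsum fun n w hw => hterm w hw n
  have hzmem : z ∈ Metric.closedBall (0 : ℂ) 1 := by simpa using hz
  have hsz : Summable (fun n => c n * z ^ n) := .of_norm_bounded hsum (hterm z hzmem)
  have hr : Filter.Tendsto (fun r : ℝ => (r : ℂ) * z) (nhdsWithin 1 (Set.Ioo 0 1)) (nhds z) := by
    have : Continuous (fun r : ℝ => (r : ℂ) * z) := by fun_prop
    simpa using (this.tendsto 1).mono_left nhdsWithin_le_nhds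
  have hlt : ∀ r ∈ Set.Ioo (0 : ℝ) 1, ‖(r : ℂ) * z‖ < 1 := by
    intro r hr
    rw [norm_mul, Complex.norm_of_nonneg hr.1.le]
    nlinarith [hr.1, hr.2, norm_nonneg z]
  have hr' : Filter.Tendsto (fun r : ℝ => (r : ℂ) * z) (nhdsWithin 1 (Set.Ioo 0 1))
      (nhdsWithin z (Metric.closedBall 0 1)) := by
    refine tendsto_nhdsWithin_iff.2 ⟨hr, ?_⟩
    filter_upwards [self_mem_nhdsWithin] with r hr
    simpa using (hlt r hr).le
  have hne : (nhdsWithin (1 : ℝ) (Set.Ioo 0 1)).NeBot := right_nhdsWithin_Ioo_neBot one_pos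
  have hphi : ContinuousAt (fun w : ℂ => (1 + w) * (1 - Complex.log (1 + w))) z := by
    have : 1 + z ∈ Complex.slitPlane := Or.inl hre
    fun_prop (disch := assumption)
  have hlim := ((hcont z hzmem).tendsto.comp hr')
  have hlim' := hphi.tendsto.comp hr
  have heq : (fun w : ℂ => ∑' n, c n * w ^ n) ∘ (fun r : ℝ => (r : ℂ) * z)
      =ᶠ[nhdsWithin 1 (Set.Ioo 0 1)]
      (fun w : ℂ => (1 + w) * (1 - Complex.log (1 + w))) ∘ (fun r : ℝ => (r : ℂ) * z) := by
    filter_upwards [self_mem_nhdsWithin] with r hr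
    exact (hdisc _ (hlt r hr)).tsum_eq
  have := tendsto_nhds_unique (hlim.congr' heq) hlim'
  rw [← this]
  exact hsz.hasSum

/-- If `φ` is a.e. the sum of an absolutely convergent series `∑ c k e^{iskθ}` and the Fourier
coefficients of `f` of index `n - s k` all vanish, then so does that of `f φ` of index `n`. -/
theorem integral_mul_hasSum_exp_eq_zero {f φ : ℝ → ℂ} {a b : ℝ} {c : ℕ → ℂ} (s n : ℤ)
    (hf : IntervalIntegrable f volume a b) (hc : Summable (fun k => ‖c k‖))
    (hφ : ∀ᵐ θ : ℝ, θ ∈ Set.uIoc a b →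
      HasSum (fun k => c k * Complex.exp (s * θ * Complex.I) ^ k) (φ θ))
    (h : ∀ k : ℕ, ∫ θ in a..b,
      f θ * Complex.exp (-((n - s * k : ℤ) : ℂ) * (θ : ℂ) * Complex.I) = 0) :
    ∫ θ in a..b, f θ * φ θ * Complex.exp (-(n : ℂ) * (θ : ℂ) * Complex.I) = 0 := by
  have hnorm : ∀ (m : ℤ) (θ : ℝ), ‖Complex.exp (-(m : ℂ) * (θ : ℂ) * Complex.I)‖ = 1 := by
    intro m θ
    have := Complex.norm_exp_ofReal_mul_I (-(m : ℝ) * θ)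
    simpa using this
  have key := hasSum_integral_of_dominated_convergence (μ := volume) (a := a) (b := b)
    (F := fun k θ => c k * (f θ * Complex.exp (-((n - s * k : ℤ) : ℂ) * (θ : ℂ) * Complex.I)))
    (f := fun θ => f θ * φ θ * Complex.exp (-(n : ℂ) * (θ : ℂ) * Complex.I))
    (fun k θ => ‖c k‖ * ‖f θ‖) ?_ ?_ ?_ ?_ ?_
  · refine key.unique ?_
    simp only [intervalIntegral.integral_const_mul, h, mul_zero]
    exact hasSum_zero
  · intro k
    exact (hf.def'.aestronglyMeasurable.mul
      (by fun_prop : Continuous _).aestronglyMeasurable).const_mul _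
  · refine fun k => Filter.Eventually.of_forall fun θ _ => ?_
    rw [norm_mul, norm_mul, hnorm, mul_one]
  · exact Filter.Eventually.of_forall fun θ _ => hc.mul_right _
  · simp only [tsum_mul_right]
    exact hf.norm.const_mul _
  · filter_upwards [hφ] with θ hθ hmem
    have := (hθ hmem).mul_left (f θ * Complex.exp (-(n : ℂ) * (θ : ℂ) * Complex.I))
    convert! this using 1
    · ext k
      rw [← Complex.exp_nat_mul, mul_mul_mul_comm, mul_comm (c k), mul_assoc _ (c k),
        mul_assoc (f θ), mul_left_comm _ (c k), ← Complex.exp_add]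
      push_cast
      ring_nf
    · ring

/-- An integrable function all of whose Fourier coefficients vanish is zero almost everywhere. -/
theorem ae_eq_zero_of_forall_integral_mul_exp_eq_zero {h : ℝ → ℂ}
    (hint : IntervalIntegrable h volume 0 (2 * π))
    (hcoeff : ∀ n : ℤ, ∫ θ in (0:ℝ)..(2 * π),
      h θ * Complex.exp (-(n : ℂ) * (θ : ℂ) * Complex.I) = 0) :
    ∀ᵐ θ : ℝ, θ ∈ Set.Ioo 0 (2 * π) → h θ = 0 := by
  have : Fact (0 < 2 * π) := ⟨two_pi_pos⟩
  have hprod : ∀ g : C(AddCircle (2 * π), ℂ),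
      IntervalIntegrable (fun θ => h θ * g (θ : AddCircle (2 * π))) volume 0 (2 * π) := by
    intro g
    exact hint.mul_continuousOn
      (g.continuous.comp (AddCircle.continuous_mk' _)).continuousOn
  let L : C(AddCircle (2 * π), ℂ) →ₗ[ℂ] ℂ :=
    { toFun := fun g => ∫ θ in (0:ℝ)..(2 * π), h θ * g (θ : AddCircle (2 * π))
      map_add' := fun g₁ g₂ => by
        simp only [ContinuousMap.add_apply, mul_add]
        exact integral_add (hprod g₁) (hprod g₂)
      map_smul' := fun c g => by
        simp only [ContinuousMap.smul_apply, smul_eq_mul, mul_left_comm _ c, RingHom.id_apply]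
        exact intervalIntegral.integral_const_mul _ _ }
  let L' : C(AddCircle (2 * π), ℂ) →L[ℂ] ℂ :=
    L.mkContinuous (∫ θ in (0:ℝ)..(2 * π), ‖h θ‖) fun g => by
      rw [← intervalIntegral.integral_mul_const]
      refine norm_integral_le_of_norm_le two_pi_pos.le
        (Filter.Eventually.of_forall fun θ _ => ?_) (hint.norm.mul_const _)
      rw [norm_mul]
      exact mul_le_mul_of_nonneg_left (g.norm_coe_le_norm _) (norm_nonneg _)
  have hL' : L' = 0 := by
    refine ContinuousLinearMap.ext_on (s := Set.range (@fourier (2 * π))) ?_ ?_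
    · rw [Submodule.dense_iff_topologicalClosure_eq_top]
      exact span_fourier_closure_eq_top
    · rintro _ ⟨n, rfl⟩
      change ∫ θ in (0:ℝ)..(2 * π), h θ * fourier n (θ : AddCircle (2 * π)) = 0
      rw [← hcoeff (-n)]
      congr 1 with θ
      rw [fourier_coe_apply]
      congr 2
      have : (π : ℂ) ≠ 0 := by exact_mod_cast pi_ne_zero
      push_cast
      field_simp
  refine isOpen_Ioo.ae_eq_zero_of_integral_contDiff_smul_eq_zero ?_ ?_
  · exact ((intervalIntegrable_iff_integrableOn_Ioo_of_le two_pi_pos.le).1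
      hint).locallyIntegrableOn
  · intro g hg _ hsupp
    have hzero : ∀ x, x ∉ Set.Ioo 0 (2 * π) → g x = 0 := fun x hx =>
      image_eq_zero_of_notMem_tsupport fun hx' => hx (hsupp hx')
    have hg0 : g 0 = 0 := hzero 0 (by simp)
    have hgp : g (2 * π) = 0 := hzero _ (by simp)
    let G : C(AddCircle (2 * π), ℂ) :=
      ⟨AddCircle.liftIco (2 * π) 0 fun x => (g x : ℂ), AddCircle.liftIco_zero_continuous
        (by simp [hg0, hgp]) (Complex.continuous_ofReal.comp hg.continuous).continuousOn⟩
    have hG : ∫ θ in (0:ℝ)..(2 * π), h θ * G (θ : AddCircle (2 * π)) = 0 :=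
      DFunLike.congr_fun hL' G
    rw [← hG, integral_of_le two_pi_pos.le, integral_Ioc_eq_integral_Ioo]
    rw [← setIntegral_eq_integral_of_forall_compl_eq_zero (s := Set.Ioo 0 (2 * π))
      fun x hx => by rw [hzero x hx, zero_smul]]
    refine setIntegral_congr_fun measurableSet_Ioo fun x hx => ?_
    change g x • h x = h x * AddCircle.liftIco (2 * π) 0 (fun x => (g x : ℂ)) x
    rw [AddCircle.liftIco_zero_coe_apply ⟨hx.1.le, hx.2⟩, Complex.real_smul, mul_comm]

/-- An integrable function whose only nonzero Fourier coefficient is the zeroth one is constant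
almost everywhere. -/
theorem exists_ae_eq_const_of_forall_integral_mul_exp_eq_zero {h : ℝ → ℂ}
    (hint : IntervalIntegrable h volume 0 (2 * π))
    (hcoeff : ∀ n : ℤ, n ≠ 0 → ∫ θ in (0:ℝ)..(2 * π),
      h θ * Complex.exp (-(n : ℂ) * (θ : ℂ) * Complex.I) = 0) :
    ∃ C : ℂ, ∀ᵐ θ : ℝ, θ ∈ Set.Ioo 0 (2 * π) → h θ = C := by
  set C : ℂ := (∫ θ in (0:ℝ)..(2 * π), h θ) / (2 * π) with hC
  refine ⟨C, ?_⟩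
  have key := ae_eq_zero_of_forall_integral_mul_exp_eq_zero (h := fun θ => h θ - C)
    (hint.sub intervalIntegrable_const) fun n => ?_
  · filter_upwards [key] with θ hθ hmem
    exact sub_eq_zero.1 (hθ hmem)
  · have hcont : Continuous fun θ : ℝ => Complex.exp (-(n : ℂ) * (θ : ℂ) * Complex.I) := by
      fun_prop
    simp only [sub_mul]
    rw [intervalIntegral.integral_sub (hint.mul_continuousOn hcont.continuousOn)
      ((hcont.intervalIntegrable _ _).const_mul _), intervalIntegral.integral_const_mul]
    rcases eq_or_ne n 0 with rfl | hn
    · simp [hC]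
    · have hexp : ∫ θ in (0:ℝ)..(2 * π),
          Complex.exp (-(n : ℂ) * (θ : ℂ) * Complex.I) = 0 := by
        have hne : -(n : ℂ) * Complex.I ≠ 0 := by simp [hn]
        simp only [mul_right_comm _ _ Complex.I]
        rw [integral_exp_mul_complex hne]
        have : Complex.exp (-(n : ℂ) * Complex.I * ((2 * π : ℝ) : ℂ)) = 1 :=
          Complex.exp_eq_one_iff.2 ⟨-n, by push_cast; ring⟩
        rw [this]
        simp
      rw [hcoeff n hn, hexp]
      simp

theorem one_add_exp_re_pos {θ : ℝ} (hθ : θ ∈ Set.Ioo 0 (2 * π)) (hne : θ ≠ π) :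
    0 < (1 + Complex.exp (θ * Complex.I)).re := by
  have h1 : cos θ ≠ -1 := by
    rw [Ne, Real.cos_eq_neg_one_iff]
    rintro ⟨k, hk⟩
    have hk1 : (-1 : ℝ) < k := by nlinarith [hθ.1, pi_pos]
    have hk2 : (k : ℝ) < 1 := by nlinarith [hθ.2, pi_pos]
    have hk0 : k = 0 := by
      have : -1 < k := by exact_mod_cast hk1
      have : k < 1 := by exact_mod_cast hk2
      omega
    exact hne (by simpa [hk0] using hk.symm)
  have h2 := (neg_one_le_cos θ).lt_of_ne' h1
  rw [Complex.add_re, Complex.exp_ofReal_mul_I_re, Complex.one_re]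
  linarith

theorem one_sub_log_one_add_re_pos {z : ℂ} (hz : ‖z‖ ≤ 1) (hre : 0 < (1 + z).re) :
    0 < (1 - Complex.log (1 + z)).re := by
  rw [Complex.sub_re, Complex.log_re, Complex.one_re]
  have h0 : 0 < ‖1 + z‖ := norm_pos_iff.2 fun h => by simp [h] at hre
  have h2 : ‖1 + z‖ ≤ 2 := (norm_add_le _ _).trans (by rw [norm_one]; linarith)
  have := log_le_log h0 h2
  linarith [log_two_lt_d9]

theorem norm_toeplitzSymbol_le_one (θ : ℝ) : ‖toeplitzSymbol θ‖ ≤ 1 := by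
  have hconj : 1 + Complex.exp (-(θ : ℂ) * Complex.I) =
      starRingEnd ℂ (1 + Complex.exp ((θ : ℂ) * Complex.I)) := by
    simp [← Complex.exp_conj]
  have harg : (1 + Complex.exp ((θ : ℂ) * Complex.I)).arg ≠ π := by
    intro h
    rw [Complex.arg_eq_pi_iff, Complex.add_re, Complex.exp_ofReal_mul_I_re, Complex.one_re] at h
    linarith [h.1, neg_one_le_cos θ]
  have hnorm : ‖1 - Complex.log (1 + Complex.exp (-(θ : ℂ) * Complex.I))‖ =
      ‖1 - Complex.log (1 + Complex.exp ((θ : ℂ) * Complex.I))‖ := by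
    rw [hconj, Complex.log_conj _ harg, ← Complex.norm_conj, map_sub, map_one, Complex.conj_conj]
  rw [toeplitzSymbol, norm_div, hnorm]
  exact div_self_le_one _

theorem measurable_toeplitzSymbol : Measurable toeplitzSymbol := by
  unfold toeplitzSymbol
  fun_prop

/-- The reciprocal of `(1 + z) (1 - Log (1 + z))` is not integrable on the unit circle. -/
theorem not_intervalIntegrable_inv_one_add_mul_one_sub_log :
    ¬ IntervalIntegrable (fun θ : ℝ => ((1 + Complex.exp (θ * Complex.I)) *
      (1 - Complex.log (1 + Complex.exp (θ * Complex.I))))⁻¹) volume 0 (2 * π) := by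
  have hev : ∀ᶠ θ in nhdsWithin π {π}ᶜ, θ ∈ Set.Ioo 0 (2 * π) ∧ θ ≠ π := by
    filter_upwards [self_mem_nhdsWithin, mem_nhdsWithin_of_mem_nhds
      (Ioo_mem_nhds pi_pos (by linarith [pi_pos] : π < 2 * π))] with θ h1 h2
    exact ⟨h2, h1⟩
  have hderiv : ∀ θ ∈ Set.Ioo 0 (2 * π), θ ≠ π → HasDerivAt (fun θ : ℝ =>
      Complex.log (1 - Complex.log (1 + Complex.exp (θ * Complex.I))))
      (-(Complex.exp (θ * Complex.I) * Complex.I / (1 + Complex.exp (θ * Complex.I))) /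
        (1 - Complex.log (1 + Complex.exp (θ * Complex.I)))) θ := by
    intro θ hθ hne
    have hre := one_add_exp_re_pos hθ hne
    have hre' := one_sub_log_one_add_re_pos (Complex.norm_exp_ofReal_mul_I θ).le hre
    have h1 : HasDerivAt (fun θ : ℝ => 1 + Complex.exp (θ * Complex.I))
        (Complex.exp (θ * Complex.I) * Complex.I) θ := by
      have : HasDerivAt (fun θ : ℝ => (θ : ℂ) * Complex.I) Complex.I θ := by
        simpa using (HasDerivAt.ofReal_comp (hasDerivAt_id θ)).mul_const Complex.I
      exact this.cexp.const_add 1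
    exact ((h1.clog_real (Or.inl hre)).const_sub 1).clog_real (Or.inl hre')
  refine not_intervalIntegrable_of_tendsto_norm_atTop_of_deriv_isBigO_punctured
    (f := fun θ : ℝ => Complex.log (1 - Complex.log (1 + Complex.exp (θ * Complex.I))))
    (c := π) ?_ ?_ ?_ (by positivity) ?_
  · filter_upwards [hev] with θ hθ
    exact (hderiv θ hθ.1 hθ.2).differentiableAt
  · have h0 : Filter.Tendsto (fun θ : ℝ => ‖1 + Complex.exp (θ * Complex.I)‖)
        (nhdsWithin π {π}ᶜ) (nhdsWithin 0 (Set.Ioi 0)) := by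
      refine tendsto_nhdsWithin_iff.2 ⟨?_, ?_⟩
      · have : Continuous (fun θ : ℝ => ‖1 + Complex.exp (θ * Complex.I)‖) := by fun_prop
        simpa [Complex.exp_pi_mul_I] using (this.tendsto π).mono_left nhdsWithin_le_nhds
      · filter_upwards [hev] with θ hθ
        have := one_add_exp_re_pos hθ.1 hθ.2
        exact norm_pos_iff.2 fun h => by simp [h] at this
    have h1 := tendsto_log_nhdsGT_zero.comp h0
    have h2 : Filter.Tendsto (fun θ : ℝ => ‖1 - Complex.log (1 + Complex.exp (θ * Complex.I))‖)
        (nhdsWithin π {π}ᶜ) Filter.atTop := by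
      refine Filter.tendsto_atTop_mono (fun θ => ?_)
        (Filter.tendsto_neg_atBot_atTop.comp h1)
      have := Complex.re_le_norm (1 - Complex.log (1 + Complex.exp (θ * Complex.I)))
      rw [Complex.sub_re, Complex.log_re, Complex.one_re] at this
      simp only [Function.comp]
      linarith
    refine Filter.tendsto_atTop_mono (fun θ => ?_) (tendsto_log_atTop.comp h2)
    have := Complex.re_le_norm
      (Complex.log (1 - Complex.log (1 + Complex.exp (θ * Complex.I))))
    rwa [Complex.log_re] at this
  · refine Asymptotics.IsBigO.of_bound 1 ?_
    filter_upwards [hev] with θ hθ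
    rw [(hderiv θ hθ.1 hθ.2).deriv]
    simp [mul_comm, div_eq_mul_inv]
  · rw [Set.uIcc_of_le two_pi_pos.le]
    constructor <;> linarith [pi_pos]

/-- A periodic function vanishing a.e. on one period vanishes a.e. -/
theorem Function.Periodic.ae_eq_zero_of_ae_Ioo {f : ℝ → ℂ} {T : ℝ} (hf : Function.Periodic f T)
    (hT : 0 < T) (h : ∀ᵐ θ : ℝ, θ ∈ Set.Ioo 0 T → f θ = 0) : ∀ᵐ θ : ℝ, f θ = 0 := by
  have hIco : ∀ᵐ θ : ℝ, θ ∈ Set.Ico 0 T → f θ = 0 := by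
    filter_upwards [h, Measure.ae_ne volume 0] with θ hθ hne hmem
    exact hθ ⟨hmem.1.lt_of_ne' hne, hmem.2⟩
  have hall : ∀ᵐ θ : ℝ, ∀ n : ℤ, θ + n • T ∈ Set.Ico 0 T → f (θ + n • T) = 0 :=
    ae_all_iff.2 fun n =>
      (measurePreserving_add_right volume (n • T)).quasiMeasurePreserving.ae hIco
  filter_upwards [hall] with θ hθ
  obtain ⟨n, hn, -⟩ := existsUnique_add_zsmul_mem_Ico hT θ 0
  rw [zero_add] at hn
  rw [← hθ n hn]
  exact (hf.zsmul n θ).symm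

/-- The Toeplitz operator `T_a` has trivial kernel on `H¹`: if `f` is
2π-periodic, integrable on `[0,2π]`, with `f̂(n) = 0` for all `n < 0`, and
`(a·f)^(n) = 0` for all `n ≥ 0` (i.e. `T_a f = 0`), then `f = 0` a.e. -/
theorem toeplitz_ker_trivial (f : ℝ → ℂ)
    (hper : ∀ θ : ℝ, f (θ + 2 * π) = f θ)
    (hint : IntervalIntegrable f volume 0 (2 * π))
    (hhardy : ∀ n : ℤ, n < 0 →
      (1 / (2 * (π : ℂ))) * ∫ θ in (0:ℝ)..(2 * π),
          f θ * Complex.exp (-(n : ℂ) * (θ : ℂ) * Complex.I) = 0)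
    (hker : ∀ n : ℤ, 0 ≤ n →
      (1 / (2 * (π : ℂ))) * ∫ θ in (0:ℝ)..(2 * π),
          toeplitzSymbol θ * f θ * Complex.exp (-(n : ℂ) * (θ : ℂ) * Complex.I) = 0) :
    ∀ᵐ θ : ℝ ∂volume, f θ = 0 := by
  obtain ⟨c, hc, hcsum⟩ := exists_summable_hasSum_one_add_mul_one_sub_log
  set φ : ℝ → ℂ := fun θ => (1 + Complex.exp (θ * Complex.I)) *
    (1 - Complex.log (1 + Complex.exp (θ * Complex.I))) with hφ
  have hpi : (1 / (2 * (π : ℂ))) ≠ 0 := by simp [pi_ne_zero]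
  have hf0 : ∀ n : ℤ, n < 0 → ∫ θ in (0:ℝ)..(2 * π),
      f θ * Complex.exp (-(n : ℂ) * (θ : ℂ) * Complex.I) = 0 := fun n hn =>
    (mul_eq_zero.1 (hhardy n hn)).resolve_left hpi
  have hg0 : ∀ n : ℤ, 0 ≤ n → ∫ θ in (0:ℝ)..(2 * π),
      toeplitzSymbol θ * f θ * Complex.exp (-(n : ℂ) * (θ : ℂ) * Complex.I) = 0 := fun n hn =>
    (mul_eq_zero.1 (hker n hn)).resolve_left hpi
  have hgint : IntervalIntegrable (fun θ => toeplitzSymbol θ * f θ) volume 0 (2 * π) := by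
    refine hint.mono_fun (measurable_toeplitzSymbol.aestronglyMeasurable.mul
      hint.def'.aestronglyMeasurable) (Filter.Eventually.of_forall fun θ => ?_)
    simp only [norm_mul]
    exact mul_le_of_le_one_left (norm_nonneg _) (norm_toeplitzSymbol_le_one θ)
  have hmem : ∀ᵐ θ : ℝ, θ ∈ Set.uIoc 0 (2 * π) → θ ∈ Set.Ioo 0 (2 * π) ∧ θ ≠ π := by
    filter_upwards [Measure.ae_ne volume π, Measure.ae_ne volume (2 * π)] with θ h1 h2 h3
    rw [Set.uIoc_of_le two_pi_pos.le] at h3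
    exact ⟨⟨h3.1, h3.2.lt_of_ne h2⟩, h1⟩
  have hexp : ∀ θ : ℝ, ‖Complex.exp (-(θ : ℂ) * Complex.I)‖ = 1 := fun θ => by
    simpa using Complex.norm_exp_ofReal_mul_I (-θ)
  have hre : ∀ θ : ℝ, (1 + Complex.exp (-(θ : ℂ) * Complex.I)).re =
      (1 + Complex.exp (θ * Complex.I)).re := fun θ => by
    have := Complex.exp_ofReal_mul_I_re (-θ)
    rw [cos_neg] at this
    push_cast at this
    rw [Complex.add_re, Complex.add_re, Complex.exp_ofReal_mul_I_re, this]
  have hneg : ∀ n : ℤ, n < 0 → ∫ θ in (0:ℝ)..(2 * π),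
      f θ * φ θ * Complex.exp (-(n : ℂ) * (θ : ℂ) * Complex.I) = 0 := by
    intro n hn
    refine integral_mul_hasSum_exp_eq_zero 1 n hint hc ?_ fun k => hf0 _ (by lia)
    filter_upwards [hmem] with θ hθ hθ'
    simpa using hcsum _ (Complex.norm_exp_ofReal_mul_I θ).le
      (one_add_exp_re_pos (hθ hθ').1 (hθ hθ').2)
  have hpos : ∀ n : ℤ, 0 < n → ∫ θ in (0:ℝ)..(2 * π),
      f θ * φ θ * Complex.exp (-(n : ℂ) * (θ : ℂ) * Complex.I) = 0 := by
    intro n hn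
    rw [← integral_mul_hasSum_exp_eq_zero (φ := fun θ : ℝ =>
      (1 + Complex.exp (-(θ : ℂ) * Complex.I)) *
        (1 - Complex.log (1 + Complex.exp (-(θ : ℂ) * Complex.I))))
      (-1) (n - 1) hgint hc ?_ fun k => hg0 _ (by lia)]
    · refine integral_congr_ae ?_
      filter_upwards [hmem] with θ hθ hθ'
      have hpos' := (hre θ).trans_gt (one_add_exp_re_pos (hθ hθ').1 (hθ hθ').2)
      have hV : 1 - Complex.log (1 + Complex.exp (-(θ : ℂ) * Complex.I)) ≠ 0 := fun h => by
        have := one_sub_log_one_add_re_pos (hexp θ).le hpos'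
        rw [h] at this
        exact lt_irrefl _ this
      have h1 : Complex.exp (-((n - 1 : ℤ) : ℂ) * (θ : ℂ) * Complex.I) =
          Complex.exp (-(n : ℂ) * (θ : ℂ) * Complex.I) * Complex.exp (θ * Complex.I) := by
        rw [← Complex.exp_add]
        push_cast
        ring_nf
      have h2 : (1 + Complex.exp (-(θ : ℂ) * Complex.I)) * Complex.exp (θ * Complex.I) =
          1 + Complex.exp (θ * Complex.I) := by
        rw [add_mul, ← Complex.exp_add]
        simp [add_comm]
      rw [h1, toeplitzSymbol, div_mul_eq_mul_div, div_mul_eq_mul_div]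
      simp only [hφ]
      rw [← mul_div_right_comm, eq_div_iff hV]
      linear_combination -(f θ * (1 - Complex.log (1 + Complex.exp (θ * Complex.I))) *
        (1 - Complex.log (1 + Complex.exp (-(θ : ℂ) * Complex.I))) *
        Complex.exp (-(n : ℂ) * (θ : ℂ) * Complex.I)) * h2
    · filter_upwards [hmem] with θ hθ hθ'
      simpa using hcsum _ (hexp θ).le
        ((hre θ).trans_gt (one_add_exp_re_pos (hθ hθ').1 (hθ hθ').2))
  have hφle : ∀ᵐ θ : ℝ, θ ∈ Set.uIoc 0 (2 * π) → ‖φ θ‖ ≤ ∑' k, ‖c k‖ := by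
    filter_upwards [hmem] with θ hθ hθ'
    have hs := hcsum _ (Complex.norm_exp_ofReal_mul_I θ).le
      (one_add_exp_re_pos (hθ hθ').1 (hθ hθ').2)
    simp only [hφ]
    rw [← hs.tsum_eq]
    refine tsum_of_norm_bounded hc.hasSum fun k => ?_
    simp [Complex.norm_exp_ofReal_mul_I]
  have hφm : Measurable φ := by fun_prop
  have hprod : IntervalIntegrable (fun θ => f θ * φ θ) volume 0 (2 * π) := by
    refine (hint.norm.mul_const (∑' k, ‖c k‖)).mono_fun' (hint.def'.aestronglyMeasurable.mul
      hφm.aestronglyMeasurable) ?_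
    rw [Filter.EventuallyLE, ae_restrict_iff' measurableSet_uIoc]
    filter_upwards [hφle] with θ hθ hθ'
    rw [norm_mul]
    exact mul_le_mul_of_nonneg_left (hθ hθ') (norm_nonneg _)
  obtain ⟨C, hC⟩ : ∃ C : ℂ, ∀ᵐ θ : ℝ, θ ∈ Set.Ioo 0 (2 * π) → f θ * φ θ = C :=
    exists_ae_eq_const_of_forall_integral_mul_exp_eq_zero hprod fun n hn =>
      hn.lt_or_gt.elim (hneg n) (hpos n)
  have hφne : ∀ θ ∈ Set.Ioo 0 (2 * π), θ ≠ π → φ θ ≠ 0 := by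
    intro θ hθ hne
    have h1 := one_add_exp_re_pos hθ hne
    have h2 := one_sub_log_one_add_re_pos (Complex.norm_exp_ofReal_mul_I θ).le h1
    exact mul_ne_zero (fun h => by simp [h] at h1) fun h => by simp [h] at h2
  have hC0 : C = 0 := by
    by_contra hne
    refine not_intervalIntegrable_inv_one_add_mul_one_sub_log
      ((hint.const_mul C⁻¹).congr_ae ?_)
    rw [Filter.EventuallyEq, ae_restrict_iff' measurableSet_uIoc]
    filter_upwards [hmem, hC] with θ hθ hθC hθ'
    have h1 := hφne θ (hθ hθ').1 (hθ hθ').2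
    rw [← hθC (hθ hθ').1] at hne ⊢
    have h2 := left_ne_zero_of_mul hne
    change (f θ * φ θ)⁻¹ * f θ = (φ θ)⁻¹
    field_simp
  refine Function.Periodic.ae_eq_zero_of_ae_Ioo hper two_pi_pos ?_
  filter_upwards [hC, Measure.ae_ne volume π] with θ hθ hne hθ'
  have := hθ hθ'
  rw [hC0] at this
  exact (mul_eq_zero.1 this).resolve_right (hφne θ hθ' hne)
end

section
/- The range of the Toeplitz operator T_a contains H^∞ (and hence is dense in H¹): for every 2π-periodic essentially bounded measurable g : ℝ → ℂ with ĝ(n) = 0 for all integers n < 0, there exists a 2π-periodic function f integrable on [0,2π] with f̂(n) = 0 for all n < 0 such that (a·f)^(n) = ĝ(n) for all integers n ≥ 0. -/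
open MeasureTheory intervalIntegral Real

open scoped ComplexConjugate

section FourierL2

open AddCircle

lemma norm_fourier_le_one {T : ℝ} (n : ℤ) (x : AddCircle T) : ‖(fourier n x : ℂ)‖ ≤ 1 := by
  rw [fourier_apply]
  exact (Circle.norm_coe _).le

variable {T : ℝ} [hT : Fact (0 < T)]

lemma fourierCoeff_conj (u : AddCircle T → ℂ) (n : ℤ) :
    fourierCoeff (fun x => conj (u x)) n = conj (fourierCoeff u (-n)) := by
  unfold fourierCoeff
  rw [← integral_conj]
  congr 1
  ext x
  rw [smul_eq_mul, smul_eq_mul, map_mul, ← fourier_neg, neg_neg]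

lemma fourierCoeff_fourier_mul (u : AddCircle T → ℂ) (n k : ℤ) :
    fourierCoeff (fun x => fourier n x * u x) k = fourierCoeff u (k - n) := by
  unfold fourierCoeff
  congr 1
  ext x
  rw [smul_eq_mul, smul_eq_mul, ← mul_assoc, ← fourier_add]
  congr 3
  ring

lemma fourierCoeff_sub {u v : AddCircle T → ℂ} (hu : Integrable u haarAddCircle)
    (hv : Integrable v haarAddCircle) (n : ℤ) :
    fourierCoeff (fun x => u x - v x) n = fourierCoeff u n - fourierCoeff v n := by
  unfold fourierCoeff
  rw [← integral_sub (hu.fourier_smul _) (hv.fourier_smul _)]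
  simp only [smul_sub]

/-- The `n`-th Fourier coefficient of a product of two `L²` functions vanishes as soon as every
term of the convolution of their Fourier coefficients does. -/
lemma fourierCoeff_mul_eq_zero {u v : AddCircle T → ℂ} (hu : MemLp u 2 haarAddCircle)
    (hv : MemLp v 2 haarAddCircle) {n : ℤ}
    (h : ∀ k, fourierCoeff u (n - k) = 0 ∨ fourierCoeff v k = 0) :
    fourierCoeff (fun x => u x * v x) n = 0 := by
  set w : AddCircle T → ℂ := fun x => fourier n x * conj (u x) with hw
  have hwL : MemLp w 2 haarAddCircle := by
    refine hu.of_le (((fourier n).continuous.aestronglyMeasurable).mul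
      (Complex.continuous_conj.comp_aestronglyMeasurable hu.1)) (Filter.Eventually.of_forall ?_)
    intro x
    rw [hw, norm_mul, RCLike.norm_conj]
    exact mul_le_of_le_one_left (norm_nonneg _) (norm_fourier_le_one n x)
  have hsum := fourierBasis.hasSum_inner_mul_inner (hwL.toLp w) (hv.toLp v)
  have hzero : ∀ i, inner ℂ (hwL.toLp w) (fourierBasis i) *
      inner ℂ (fourierBasis i) (hv.toLp v) = 0 := by
    intro i
    rw [← inner_conj_symm, ← fourierBasis.repr_apply_apply, ← fourierBasis.repr_apply_apply,
      fourierBasis_repr, fourierBasis_repr, fourierCoeff_congr_ae hwL.coeFn_toLp,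
      fourierCoeff_congr_ae hv.coeFn_toLp, hw, fourierCoeff_fourier_mul, fourierCoeff_conj,
      neg_sub]
    rcases h i with h | h <;> simp [h]
  simp only [hzero] at hsum
  have hin := hsum.unique hasSum_zero
  rw [L2.inner_def] at hin
  rw [← hin]
  refine integral_congr_ae ?_
  filter_upwards [hwL.coeFn_toLp, hv.coeFn_toLp] with x h1 h2
  rw [h1, h2, RCLike.inner_apply', hw]
  simp only [smul_eq_mul, map_mul, Complex.conj_conj, fourier_neg]
  ring

/-- The Riesz projection on `L²` of the circle. -/
lemma exists_riesz_projection {w : AddCircle T → ℂ} (hw : MemLp w 2 haarAddCircle) :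
    ∃ p : AddCircle T → ℂ, MemLp p 2 haarAddCircle ∧ (∀ n < 0, fourierCoeff p n = 0) ∧
      ∀ n, 0 ≤ n → fourierCoeff (fun x => w x - p x) n = 0 := by
  let N : Submodule ℂ (Lp ℂ 2 (@haarAddCircle T hT)) :=
    Submodule.span ℂ (Set.range fun n : {n : ℤ // n < 0} => fourierBasis (n : ℤ))
  let q := Nᗮ.starProjection (hw.toLp w)
  have hcoeff : ∀ (y : Lp ℂ 2 (@haarAddCircle T hT)) (n : ℤ),
      fourierCoeff y n = inner ℂ (fourierBasis n) y := fun y n => by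
    rw [← fourierBasis.repr_apply_apply, fourierBasis_repr]
  refine ⟨q, Lp.memLp q, fun n hn => ?_, fun n hn => ?_⟩
  · rw [hcoeff]
    exact Submodule.mem_orthogonal _ _ |>.1 (Submodule.starProjection_apply_mem Nᗮ _) _
      (Submodule.subset_span ⟨⟨n, hn⟩, rfl⟩)
  · have hn' : fourierBasis n ∈ Nᗮ := by
      rw [Submodule.mem_orthogonal]
      intro y hy
      induction hy using Submodule.span_induction with
      | mem y hy =>
        obtain ⟨⟨m, hm⟩, rfl⟩ := hy
        exact fourierBasis.orthonormal.2 (by dsimp only; omega)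
      | zero => simp
      | add y z _ _ hy hz => rw [inner_add_left, hy, hz, add_zero]
      | smul c y _ hy => rw [inner_smul_left, hy, mul_zero]
    have hae : (fun x => w x - q x) =ᵐ[haarAddCircle] (hw.toLp w - q : Lp ℂ 2 haarAddCircle) := by
      filter_upwards [Lp.coeFn_sub (hw.toLp w) q, hw.coeFn_toLp] with x h1 h2
      rw [h1, Pi.sub_apply, h2]
    rw [fourierCoeff_congr_ae hae, hcoeff]
    exact Submodule.mem_orthogonal _ _ |>.1
      (Submodule.sub_starProjection_mem_orthogonal (K := Nᗮ) (hw.toLp w)) _ hn'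

end FourierL2

section OuterFunction

/-- The outer function `1 - Log (1 + z)` in terms of which the symbol is `F(z) / F(z̄)`. -/
noncomputable def outerSymbol (z : ℂ) : ℂ := 1 - Complex.log (1 + z)

lemma one_sub_log_two_le_re_outerSymbol {z : ℂ} (hz : ‖z‖ ≤ 1) :
    1 - Real.log 2 ≤ (outerSymbol z).re := by
  have h2 : ‖1 + z‖ ≤ 2 := (norm_add_le _ _).trans (by rw [norm_one]; linarith)
  have hlog : Real.log ‖1 + z‖ ≤ Real.log 2 := by
    rcases (norm_nonneg (1 + z)).eq_or_lt with h | h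
    · rw [← h, Real.log_zero]; positivity
    · exact Real.log_le_log h h2
  rw [outerSymbol, Complex.sub_re, Complex.log_re, Complex.one_re]
  linarith

lemma one_sub_log_two_pos : 0 < 1 - Real.log 2 := by
  linarith [Real.log_two_lt_d9]

lemma outerSymbol_ne_zero {z : ℂ} (hz : ‖z‖ ≤ 1) : outerSymbol z ≠ 0 := fun h => by
  have := one_sub_log_two_le_re_outerSymbol hz
  rw [h, Complex.zero_re] at this
  linarith [one_sub_log_two_pos]

lemma norm_inv_outerSymbol_le {z : ℂ} (hz : ‖z‖ ≤ 1) :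
    ‖(outerSymbol z)⁻¹‖ ≤ (1 - Real.log 2)⁻¹ := by
  rw [norm_inv]
  exact inv_anti₀ one_sub_log_two_pos
    ((one_sub_log_two_le_re_outerSymbol hz).trans (Complex.re_le_norm _))

lemma outerSymbol_conj {z : ℂ} (hz : ‖z‖ ≤ 1) :
    outerSymbol (conj z) = conj (outerSymbol z) := by
  have harg : (1 + z).arg ≠ π := by
    intro h
    have := (Complex.arg_eq_pi_iff.1 h).1
    have h' := Complex.abs_re_le_norm z
    rw [Complex.add_re, Complex.one_re] at this
    linarith [neg_le_of_abs_le (h'.trans hz)]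
  rw [outerSymbol, outerSymbol, map_sub, map_one, ← Complex.log_conj _ harg, map_add, map_one]

lemma measurable_outerSymbol : Measurable outerSymbol := by
  unfold outerSymbol
  fun_prop

lemma one_add_mem_slitPlane {z : ℂ} (hz : ‖z‖ ≤ 1) (hz' : z ≠ -1) :
    1 + z ∈ Complex.slitPlane := by
  rw [Complex.mem_slitPlane_iff]
  by_contra! h
  obtain ⟨h1, h2⟩ := h
  have h' := neg_le_of_abs_le ((Complex.abs_re_le_norm z).trans hz)
  simp only [Complex.add_re, Complex.one_re, Complex.add_im, Complex.one_im, zero_add] at h1 h2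
  exact hz' (Complex.ext (by simp; linarith) (by simp [h2]))

lemma tendsto_inv_outerSymbol :
    Filter.Tendsto (fun z => (outerSymbol z)⁻¹) (nhdsWithin (-1) {-1}ᶜ) (nhds 0) := by
  have h1 : Filter.Tendsto (fun z : ℂ => ‖1 + z‖) (nhdsWithin (-1) {-1}ᶜ)
      (nhdsWithin 0 {0}ᶜ) := by
    refine tendsto_nhdsWithin_iff.2 ⟨?_, ?_⟩
    · have : Continuous fun z : ℂ => ‖1 + z‖ := by fun_prop
      simpa using (this.tendsto (-1)).mono_left nhdsWithin_le_nhds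
    · filter_upwards [self_mem_nhdsWithin] with z hz
      have : 1 + z ≠ 0 := fun h => hz (by simp; linear_combination h)
      simpa using this
  have h2 := Real.tendsto_log_nhdsNE_zero.comp h1
  have h3 : Filter.Tendsto (fun z => ‖outerSymbol z‖) (nhdsWithin (-1) {-1}ᶜ) Filter.atTop := by
    refine Filter.tendsto_atTop_mono (fun z => ?_)
      (Filter.tendsto_atTop_add_const_left _ 1 (Filter.tendsto_neg_atBot_atTop.comp h2))
    refine le_trans (le_of_eq ?_) (Complex.re_le_norm (outerSymbol z))
    simp [outerSymbol, Complex.log_re]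
    ring
  exact tendsto_zero_iff_norm_tendsto_zero.2 
    (by simpa [Pi.inv_def] using h3.inv_tendsto_atTop)

lemma circleIntegral_pow_mul_inv_outerSymbol (m : ℕ) :
    (∮ z in C(0, 1), z ^ m * (outerSymbol z)⁻¹) = 0 := by
  let G : ℂ → ℂ := Function.update (fun z => (outerSymbol z)⁻¹) (-1) 0
  have hdiff : ∀ z, ‖z‖ ≤ 1 → z ≠ -1 → DifferentiableAt ℂ (fun z => (outerSymbol z)⁻¹) z := by
    intro z hz hz'
    refine DifferentiableAt.inv ?_ (outerSymbol_ne_zero hz)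
    have := one_add_mem_slitPlane hz hz'
    unfold outerSymbol
    exact (differentiableAt_const _).sub (((differentiableAt_const _).add differentiableAt_id).clog
      this)
  have hev : ∀ z ≠ -1, G =ᶠ[nhds z] fun z => (outerSymbol z)⁻¹ := by
    intro z hz
    filter_upwards [isOpen_ne.mem_nhds hz] with y hy
    exact Function.update_of_ne hy _ _
  have hcirc : (∮ z in C(0, 1), z ^ m * (outerSymbol z)⁻¹) = ∮ z in C(0, 1), z ^ m * G z := by
    refine intervalIntegral.integral_congr_ae ?_
    have hnull : ∀ᵐ θ : ℝ, θ ≠ π := by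
      simp [ae_iff, MeasureTheory.measure_singleton]
    filter_upwards [hnull] with θ hθ hmem
    rw [Set.uIoc_of_le Real.two_pi_pos.le] at hmem
    have : circleMap 0 1 θ ≠ -1 := by
      intro h
      have hre := congrArg Complex.re h
      have : Real.cos θ = -1 := by simpa [circleMap, Complex.exp_ofReal_mul_I_re] using hre
      obtain ⟨k, hk⟩ := Real.cos_eq_neg_one_iff.1 this
      have hπ := Real.pi_pos
      have h0 : k = 0 := by
        have h1 : (k : ℝ) < 1 := by by_contra! hc; nlinarith [hmem.2]
        have h2 : (-1 : ℝ) < k := by by_contra! hc; nlinarith [hmem.1]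
        have h1' : k < 1 := by exact_mod_cast h1
        have h2' : -1 < k := by exact_mod_cast h2
        omega
      apply hθ
      rw [← hk, h0]
      simp
    simp only [G, Function.update_of_ne this]
  rw [hcirc]
  refine Complex.circleIntegral_eq_zero_of_differentiable_on_off_countable (s := {-1}) zero_le_one
    (Set.countable_singleton _) ?_ ?_
  · refine (continuous_pow m).continuousOn.mul fun z hz => ContinuousAt.continuousWithinAt ?_
    by_cases h : z = -1
    · subst h
      exact continuousAt_update_same.2 tendsto_inv_outerSymbol
    · exact (hdiff z (by simpa using hz) h).continuousAt.congr (hev z h).symm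
  · rintro z ⟨hz, hz'⟩
    exact (differentiableAt_id.pow m).mul ((hdiff z (by simpa using (Metric.mem_ball.1 hz).le)
      hz').congr_of_eventuallyEq (hev z hz'))

instance fact_two_pi_pos : Fact (0 < 2 * π) := ⟨Real.two_pi_pos⟩

lemma fourier_coe_two_pi (n : ℤ) (θ : ℝ) :
    (fourier n (θ : AddCircle (2 * π)) : ℂ) = Complex.exp (n * θ * Complex.I) := by
  rw [fourier_coe_apply]
  congr 1
  have : (π : ℂ) ≠ 0 := by exact_mod_cast Real.pi_ne_zero
  push_cast
  field_simp

lemma fourierCoeff_two_pi (u : AddCircle (2 * π) → ℂ) (n : ℤ) :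
    fourierCoeff u n = (1 / (2 * (π : ℂ))) * ∫ θ in (0:ℝ)..(2 * π),
      u θ * Complex.exp (-(n : ℂ) * (θ : ℂ) * Complex.I) := by
  rw [fourierCoeff_eq_intervalIntegral u n 0, zero_add, Complex.real_smul]
  push_cast
  congr 2
  ext θ
  rw [smul_eq_mul, mul_comm, fourier_coe_two_pi]
  push_cast
  rfl

lemma fourierCoeff_inv_outerSymbol {n : ℤ} (hn : n < 0) :
    fourierCoeff (fun x : AddCircle (2 * π) => (outerSymbol (fourier 1 x))⁻¹) n = 0 := by
  obtain ⟨m, rfl⟩ : ∃ m : ℕ, n = -(m + 1 : ℤ) := ⟨(-n - 1).toNat, by omega⟩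
  have h := circleIntegral_pow_mul_inv_outerSymbol m
  rw [circleIntegral] at h
  rw [fourierCoeff_two_pi]
  have : ∀ θ : ℝ, deriv (circleMap 0 1) θ • (circleMap 0 1 θ ^ m *
      (outerSymbol (circleMap 0 1 θ))⁻¹) = Complex.I * ((outerSymbol
        (fourier 1 (θ : AddCircle (2 * π))))⁻¹ *
      Complex.exp (-((-(m + 1 : ℤ) : ℤ) : ℂ) * θ * Complex.I)) := by
    intro θ
    rw [fourier_coe_two_pi]
    simp only [deriv_circleMap, circleMap_zero, Complex.ofReal_one, one_mul, smul_eq_mul,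
      Int.cast_one]
    rw [← Complex.exp_nat_mul]
    have : Complex.exp (-((-(m + 1 : ℤ) : ℤ) : ℂ) * θ * Complex.I) =
        Complex.exp (θ * Complex.I) * Complex.exp (m * (θ * Complex.I)) := by
      rw [← Complex.exp_add]
      congr 1
      push_cast
      ring
    rw [this]
    ring
  simp only [this, intervalIntegral.integral_const_mul, mul_eq_zero, Complex.I_ne_zero,
    false_or] at h
  rw [h, mul_zero]

lemma norm_one_add_exp_ge {θ : ℝ} (h0 : 0 ≤ θ) (h1 : θ ≤ 2 * π) :
    2 / π * |θ - π| ≤ ‖1 + Complex.exp (θ * Complex.I)‖ := by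
  have hsq : ‖1 + Complex.exp (θ * Complex.I)‖ = 2 * |Real.sin ((θ - π) / 2)| := by
    have : 1 + Complex.exp (θ * Complex.I) =
        Complex.exp ((θ / 2 : ℝ) * Complex.I) * (2 * Real.cos (θ / 2) : ℝ) := by
      push_cast
      rw [Complex.cos, show (θ : ℂ) * Complex.I = θ / 2 * Complex.I + θ / 2 * Complex.I by ring,
        Complex.exp_add, neg_mul, Complex.exp_neg]
      field_simp
      ring
    rw [this, norm_mul, Complex.norm_exp_ofReal_mul_I, one_mul, Complex.norm_real, Real.norm_eq_abs,
      abs_mul, abs_two, sub_div, Real.sin_sub_pi_div_two, abs_neg]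
  have hle : |(θ - π) / 2| ≤ π / 2 := by
    rw [abs_le]; constructor <;> linarith
  have := Real.mul_abs_le_abs_sin hle
  rw [hsq, abs_div, abs_two] at *
  linarith

lemma abs_log_le_rpow {x : ℝ} (h0 : 0 < x) (h2 : x ≤ 2) :
    |Real.log x| ≤ 1 + 4 * x ^ (-(1 / 4) : ℝ) := by
  have hx : 0 < x ^ (-(1 / 4) : ℝ) := Real.rpow_pos_of_pos h0 _
  rcases le_total x 1 with h | h
  · have := Real.abs_log_mul_self_rpow_lt x (1 / 4) h0 h (by norm_num)
    rw [abs_mul, abs_of_pos (Real.rpow_pos_of_pos h0 _)] at this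
    rw [Real.rpow_neg h0.le]
    have hy := Real.rpow_pos_of_pos h0 (1 / 4)
    have : |Real.log x| ≤ 4 * (x ^ (1 / 4 : ℝ))⁻¹ := by
      rw [← div_eq_mul_inv, le_div_iff₀ hy]
      linarith
    linarith
  · rw [abs_of_nonneg (Real.log_nonneg h)]
    have := Real.log_le_log h0 h2
    linarith [Real.log_two_lt_d9]

lemma norm_outerSymbol_sq_le {θ : ℝ} (h0 : 0 ≤ θ) (h1 : θ ≤ 2 * π) (hπ : θ ≠ π) :
    ‖outerSymbol (Complex.exp (θ * Complex.I))‖ ^ 2 ≤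
      72 + 32 * ((2 / π) ^ (-(1 / 2) : ℝ) * |θ - π| ^ (-(1 / 2) : ℝ)) := by
  set w := 1 + Complex.exp (θ * Complex.I) with hw
  have hpos : 0 < 2 / π * |θ - π| :=
    mul_pos (div_pos two_pos Real.pi_pos) (abs_pos.2 (sub_ne_zero.2 hπ))
  have hge : 2 / π * |θ - π| ≤ ‖w‖ := norm_one_add_exp_ge h0 h1
  have hwpos : 0 < ‖w‖ := hpos.trans_le hge
  have hw2 : ‖w‖ ≤ 2 := by
    refine (norm_add_le _ _).trans ?_
    rw [Complex.norm_exp_ofReal_mul_I, norm_one]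
    norm_num
  set y := ‖w‖ ^ (-(1 / 4) : ℝ) with hy
  have hF : ‖outerSymbol (Complex.exp (θ * Complex.I))‖ ≤ 6 + 4 * y := by
    rw [outerSymbol, ← hw]
    have hlog : ‖Complex.log w‖ ≤ |Real.log ‖w‖| + π := by
      refine (Complex.norm_le_abs_re_add_abs_im _).trans ?_
      rw [Complex.log_re, Complex.log_im]
      gcongr
      exact Complex.abs_arg_le_pi w
    have := norm_sub_le 1 (Complex.log w)
    rw [norm_one] at this
    linarith [abs_log_le_rpow hwpos hw2, Real.pi_lt_four]
  have hy2 : y ^ 2 ≤ (2 / π) ^ (-(1 / 2) : ℝ) * |θ - π| ^ (-(1 / 2) : ℝ) := by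
    rw [hy, ← Real.rpow_natCast, ← Real.rpow_mul hwpos.le,
      ← Real.mul_rpow (div_pos two_pos Real.pi_pos).le (abs_nonneg _)]
    norm_num
    exact Real.rpow_le_rpow_of_nonpos hpos hge (by norm_num)
  have hF2 := pow_le_pow_left₀ (norm_nonneg _) hF 2
  nlinarith [sq_nonneg (6 - 4 * y)]

lemma intervalIntegrable_abs_sub_rpow {r : ℝ} (hr : -1 < r) (c a b : ℝ) :
    IntervalIntegrable (fun x => |x - c| ^ r) volume a b := by
  have h := ((intervalIntegral.intervalIntegrable_cpow' (a := a - c) (b := b - c) (r := (r : ℂ))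
    (by simpa using hr)).norm).comp_sub_right c
  simp only [sub_add_cancel] at h
  refine h.congr_ae ?_
  have hne : ∀ᵐ x ∂(volume.restrict (Set.uIoc a b)), x ≠ c :=
    ae_restrict_of_ae (by simp [ae_iff, MeasureTheory.measure_singleton])
  filter_upwards [hne] with x hx
  rw [Complex.norm_cpow_of_ne_zero (by exact_mod_cast sub_ne_zero.2 hx)]
  simp [-Complex.ofReal_sub]

open AddCircle in
lemma memLp_outerSymbol :
    MemLp (fun x : AddCircle (2 * π) => outerSymbol (fourier 1 x)) 2 haarAddCircle := by
  have hmeas : Measurable fun x : AddCircle (2 * π) => outerSymbol (fourier 1 x) :=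
    measurable_outerSymbol.comp (fourier 1).continuous.measurable
  rw [memLp_haarAddCircle_iff]
  have hmp := AddCircle.measurePreserving_mk (2 * π) 0
  rw [← hmp.map_eq, memLp_map_measure_iff (hmeas.aestronglyMeasurable) hmp.measurable.aemeasurable,
    memLp_two_iff_integrable_sq_norm
      (hmeas.comp hmp.measurable).aestronglyMeasurable, zero_add]
  have hint := ((intervalIntegrable_abs_sub_rpow (r := -(1 / 2)) (by norm_num) π 0
    (2 * π)).const_mul ((2 / π) ^ (-(1 / 2) : ℝ))).const_mul 32
  have hint2 := ((intervalIntegrable_const (c := (72 : ℝ))).add hint).1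
  refine Integrable.mono' hint2
    ((hmeas.comp hmp.measurable).norm.pow_const 2).aestronglyMeasurable ?_
  have hne : ∀ᵐ x : ℝ, x ≠ π := by simp [ae_iff, MeasureTheory.measure_singleton]
  filter_upwards [ae_restrict_mem measurableSet_Ioc, ae_restrict_of_ae hne] with θ hθ hθ'
  have := norm_outerSymbol_sq_le hθ.1.le hθ.2 hθ'
  rw [Real.norm_of_nonneg (by positivity)]
  simpa only [Function.comp_apply, fourier_coe_two_pi, Int.cast_one, one_mul] using this

open AddCircle in
/-- Every product `F̄ g` with `g` bounded has a Riesz projection `p` in `H²`, and `p / F` solves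
`T_a f = g`. -/
lemma exists_toeplitz_preimage {g : AddCircle (2 * π) → ℂ} (hg : MemLp g ⊤ haarAddCircle) :
    ∃ f : AddCircle (2 * π) → ℂ, MemLp f 2 haarAddCircle ∧ (∀ n < 0, fourierCoeff f n = 0) ∧
      ∀ n, 0 ≤ n → fourierCoeff (fun x => outerSymbol (fourier 1 x) /
        outerSymbol (fourier (-1) x) * f x) n = fourierCoeff g n := by
  set F : AddCircle (2 * π) → ℂ := fun x => outerSymbol (fourier 1 x) with hF
  have hFne : ∀ x, F x ≠ 0 := fun x => outerSymbol_ne_zero (norm_fourier_le_one 1 x)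
  have hFL : MemLp F 2 haarAddCircle := memLp_outerSymbol
  have hconj : ∀ x : AddCircle (2 * π), outerSymbol (fourier (-1) x) = conj (F x) := fun x => by
    rw [fourier_neg, outerSymbol_conj (norm_fourier_le_one 1 x)]
  have hFm : Measurable F := measurable_outerSymbol.comp (fourier 1).continuous.measurable
  have hinv : MemLp (fun x => (F x)⁻¹) ⊤ haarAddCircle :=
    memLp_top_of_bound hFm.inv.aestronglyMeasurable (1 - Real.log 2)⁻¹
      (Filter.Eventually.of_forall fun x => norm_inv_outerSymbol_le (norm_fourier_le_one 1 x))
  have hinv2 : MemLp (fun x => (F x)⁻¹) 2 haarAddCircle := hinv.mono_exponent le_top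
  have hFL' : MemLp (fun x => conj (F x)) 2 haarAddCircle := hFL.star
  have hinv' : MemLp (fun x => conj (F x)⁻¹) ⊤ haarAddCircle := hinv.star
  have hinv2' : MemLp (fun x => conj (F x)⁻¹) 2 haarAddCircle := hinv2.star
  have hw : MemLp (fun x => g x * conj (F x)) 2 haarAddCircle := hFL'.mul hg
  obtain ⟨p, hp, hpneg, hpnonneg⟩ := exists_riesz_projection hw
  have hh : MemLp (fun x => g x * conj (F x) - p x) 2 haarAddCircle := hw.sub hp
  refine ⟨fun x => (F x)⁻¹ * p x, hp.mul hinv, fun n hn => ?_, fun n hn => ?_⟩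
  · refine fourierCoeff_mul_eq_zero hinv2 hp fun k => ?_
    rcases lt_or_ge k 0 with hk | hk
    · exact Or.inr (hpneg k hk)
    · exact Or.inl (fourierCoeff_inv_outerSymbol (by omega))
  · have heq : (fun x => F x / outerSymbol (fourier (-1) x) * ((F x)⁻¹ * p x)) =
        fun x => g x - conj (F x)⁻¹ * (g x * conj (F x) - p x) := by
      ext x
      have h1 := hFne x
      have h2 : conj (F x) ≠ 0 := (map_ne_zero _).2 h1
      rw [hconj, map_inv₀]
      field_simp
      ring
    have hprod : MemLp (fun x => conj (F x)⁻¹ * (g x * conj (F x) - p x)) 2 haarAddCircle :=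
      hh.mul hinv'
    rw [heq, fourierCoeff_sub (hg.integrable le_top) (hprod.integrable one_le_two),
      fourierCoeff_mul_eq_zero hinv2' hh, sub_zero]
    intro k
    rcases lt_or_ge k 0 with hk | hk
    · left
      rw [fourierCoeff_conj, fourierCoeff_inv_outerSymbol (by omega), map_zero]
    · exact Or.inr (hpnonneg k hk)

end OuterFunction

/-- The range of `T_a` contains `H^∞`: for every 2π-periodic essentially
bounded measurable `g` with `ĝ(n) = 0` for `n < 0`, there is a 2π-periodic integrable `f`
with `f̂(n) = 0` for `n < 0` such that `(a·f)^(n) = ĝ(n)` for all `n ≥ 0`, i.e. `T_a f = g`. -/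
theorem toeplitz_range_contains_Hinfty (g : ℝ → ℂ)
    (hgper : ∀ θ : ℝ, g (θ + 2 * π) = g θ)
    (hgmeas : Measurable g)
    (hgbdd : ∃ M : ℝ, ∀ᵐ θ : ℝ ∂volume, ‖g θ‖ ≤ M)
    (hghardy : ∀ n : ℤ, n < 0 →
      (1 / (2 * (π : ℂ))) * ∫ θ in (0:ℝ)..(2 * π),
          g θ * Complex.exp (-(n : ℂ) * (θ : ℂ) * Complex.I) = 0) :
    ∃ f : ℝ → ℂ,
      (∀ θ : ℝ, f (θ + 2 * π) = f θ) ∧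
      IntervalIntegrable f volume 0 (2 * π) ∧
      (∀ n : ℤ, n < 0 →
        (1 / (2 * (π : ℂ))) * ∫ θ in (0:ℝ)..(2 * π),
            f θ * Complex.exp (-(n : ℂ) * (θ : ℂ) * Complex.I) = 0) ∧
      (∀ n : ℤ, 0 ≤ n →
        (1 / (2 * (π : ℂ))) * ∫ θ in (0:ℝ)..(2 * π),
            toeplitzSymbol θ * f θ * Complex.exp (-(n : ℂ) * (θ : ℂ) * Complex.I) =
          (1 / (2 * (π : ℂ))) * ∫ θ in (0:ℝ)..(2 * π),
            g θ * Complex.exp (-(n : ℂ) * (θ : ℂ) * Complex.I)) := by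
  obtain ⟨M, hM⟩ := hgbdd
  let G : AddCircle (2 * π) → ℂ := Function.Periodic.lift hgper
  have hGcoe : ∀ θ : ℝ, G θ = g θ := fun θ => Function.Periodic.lift_coe hgper θ
  have hmp := AddCircle.measurePreserving_mk (2 * π) 0
  have hGm : Measurable G := by
    have : G = fun x => g (AddCircle.measurableEquivIoc (2 * π) 0 x) := by
      ext x
      obtain ⟨y, rfl⟩ := (AddCircle.measurableEquivIoc (2 * π) 0).symm.surjective x
      rw [MeasurableEquiv.apply_symm_apply]
      exact hGcoe y
    rw [this]
    exact hgmeas.comp (measurable_subtype_coe.comp (MeasurableEquiv.measurable _))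
  have hGL : MemLp G ⊤ AddCircle.haarAddCircle := by
    rw [memLp_haarAddCircle_iff]
    refine memLp_top_of_bound hGm.aestronglyMeasurable M ?_
    rw [← hmp.map_eq, ae_map_iff hmp.measurable.aemeasurable
      (measurableSet_le hGm.norm measurable_const)]
    filter_upwards [ae_restrict_of_ae hM] with θ hθ
    rwa [hGcoe]
  obtain ⟨f, hfL, hfneg, hf⟩ := exists_toeplitz_preimage hGL
  refine ⟨fun θ => f θ, fun θ => congrArg f (AddCircle.coe_add_period _ θ), ?_, fun n hn => ?_,
    fun n hn => ?_⟩
  · have hfi : Integrable f (volume : Measure (AddCircle (2 * π))) :=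
      (memLp_haarAddCircle_iff.1 hfL).integrable one_le_two
    rw [intervalIntegrable_iff_integrableOn_Ioc_of_le Real.two_pi_pos.le]
    simpa only [zero_add] using! hmp.integrable_comp_of_integrable hfi
  · rw [← fourierCoeff_two_pi, hfneg n hn]
  · have h := hf n hn
    rw [fourierCoeff_two_pi, fourierCoeff_two_pi] at h
    simpa only [hGcoe, fourier_coe_two_pi, outerSymbol, toeplitzSymbol, Int.cast_one, Int.cast_neg,
      one_mul, neg_mul] using h
end

section
/- Define g(θ) = 1 / ((1 + e^{iθ}) · (1 - Log(1 + e^{iθ})) · (Log(1 - Log(1 + e^{iθ})) + 2)²) for θ ≢ π (mod 2π). Then g is integrable on [0,2π] with ĝ(n) = 0 for all integers n < 0 (i.e. g ∈ H¹ of the circle), yet g has no preimage under the Toeplitz operator T_a: there is NO 2π-periodic function f integrable on [0,2π] with f̂(n) = 0 for all n < 0 satisfying (a·f)^(n) = ĝ(n) for all integers n ≥ 0. Consequently the range of T_a is a proper (dense) subspace of H¹, and T_a is not Fredholm on H¹. -/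
open MeasureTheory intervalIntegral Real

/-- The boundary value of `g(z) = (1+z)⁻¹(1-ln(1+z))⁻¹(ln(1-ln(1+z))+2)⁻²`. -/
noncomputable def toeplitzTestFun (θ : ℝ) : ℂ :=
  1 / ((1 + Complex.exp ((θ : ℂ) * Complex.I)) *
    (1 - Complex.log (1 + Complex.exp ((θ : ℂ) * Complex.I))) *
    (Complex.log (1 - Complex.log (1 + Complex.exp ((θ : ℂ) * Complex.I))) + 2) ^ 2)

namespace ToeplitzLog

open Set Filter Topology

/-- The real profile `1 - log d` of `1 - Log (1 + z)` at distance `d` from `-1`. -/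
noncomputable def profile (d : ℝ) : ℝ := 1 - Real.log d

/-- The profile of the test function at distance `d` from `-1`. -/
noncomputable def majorant (d : ℝ) : ℝ :=
  (d * profile d * (Real.log (profile d) + 2) ^ 2)⁻¹

lemma profile_lower {d : ℝ} (h0 : 0 < d) (h2 : d ≤ 2) : 3 / 10 ≤ profile d := by
  have h := Real.log_le_log h0 h2
  have := Real.log_two_lt_d9
  unfold profile
  linarith

lemma log_add_two_lower {y : ℝ} (h : 3 / 10 ≤ y) : 1 / 2 ≤ Real.log y + 2 := by
  have h1 : Real.log (3 / 10) ≤ Real.log y := Real.log_le_log (by norm_num) h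
  have he := Real.exp_one_gt_d9
  have h2 : 1 - (3 / 10 * Real.exp 1)⁻¹ ≤ Real.log (3 / 10 * Real.exp 1) :=
    Real.one_sub_inv_le_log_of_pos (by positivity)
  rw [Real.log_mul (by norm_num) (by positivity), Real.log_exp] at h2
  have h3 : (3 / 10 * Real.exp 1)⁻¹ ≤ 3 / 2 := by
    rw [inv_le_comm₀ (by positivity) (by norm_num)]
    linarith
  linarith

lemma log_profile_lower {d : ℝ} (h0 : 0 < d) (h2 : d ≤ 2) :
    1 / 2 ≤ Real.log (profile d) + 2 :=
  log_add_two_lower (profile_lower h0 h2)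

lemma profile_pos {d : ℝ} (h0 : 0 < d) (h2 : d ≤ 2) : 0 < profile d := by
  linarith [profile_lower h0 h2]

lemma log_profile_pos {d : ℝ} (h0 : 0 < d) (h2 : d ≤ 2) : 0 < Real.log (profile d) + 2 := by
  linarith [log_profile_lower h0 h2]

lemma majorant_pos {d : ℝ} (h0 : 0 < d) (h2 : d ≤ 2) : 0 < majorant d := by
  have := profile_pos h0 h2
  have := log_profile_pos h0 h2
  unfold majorant
  positivity

lemma hasDerivAt_profile {d : ℝ} (h0 : 0 < d) : HasDerivAt profile (-d⁻¹) d := by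
  unfold profile
  simpa using (Real.hasDerivAt_log h0.ne').const_sub 1

lemma hasDerivAt_log_profile {d : ℝ} (h0 : 0 < d) (h2 : d ≤ 2) :
    HasDerivAt (fun d => Real.log (profile d) + 2) (-d⁻¹ / profile d) d :=
  ((hasDerivAt_profile h0).log (profile_pos h0 h2).ne').add_const 2

lemma hasDerivAt_inv_log_profile {d : ℝ} (h0 : 0 < d) (h2 : d ≤ 2) :
    HasDerivAt (fun d => (Real.log (profile d) + 2)⁻¹) (majorant d) d := by
  have h1 := profile_pos h0 h2
  have h3 := log_profile_pos h0 h2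
  refine ((hasDerivAt_log_profile h0 h2).fun_inv h3.ne').congr_deriv ?_
  unfold majorant
  field_simp

lemma monotoneOn_denominator :
    MonotoneOn (fun d => d * profile d * (Real.log (profile d) + 2) ^ 2)
      (Ioc 0 (Real.exp (-1))) := by
  have he : Real.exp (-1) ≤ 1 := by simp
  have key : ∀ d ∈ Ioc 0 (Real.exp (-1)),
      HasDerivAt (fun d => d * profile d * (Real.log (profile d) + 2) ^ 2)
        ((Real.log (profile d) + 2) *
          ((profile d - 1) * (Real.log (profile d) + 2) - 2)) d := by
    intro d hd
    have h2 : d ≤ 2 := by linarith [hd.2]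
    have h1 := profile_pos hd.1 h2
    have hd0 := hd.1
    refine (((hasDerivAt_id' d).fun_mul (hasDerivAt_profile hd.1)).fun_mul
      ((hasDerivAt_log_profile hd.1 h2).fun_pow 2)).congr_deriv ?_
    field_simp
    ring
  apply monotoneOn_of_deriv_nonneg (convex_Ioc _ _)
  · exact fun d hd => (key d hd).continuousAt.continuousWithinAt
  · exact fun d hd => (key d (interior_subset hd)).differentiableAt.differentiableWithinAt
  · intro d hd
    have hd := interior_subset hd
    rw [(key d hd).deriv]
    have h2 : 2 ≤ profile d := by
      have := Real.log_le_log hd.1 hd.2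
      rw [Real.log_exp] at this
      unfold profile; linarith
    have h3 : 0 ≤ Real.log (profile d) := Real.log_nonneg (by linarith)
    have h4 : 1 * 2 ≤ (profile d - 1) * (Real.log (profile d) + 2) := by
      gcongr <;> linarith
    exact mul_nonneg (by linarith) (by linarith)

lemma majorant_antitone {d e : ℝ} (h0 : 0 < d) (hde : d ≤ e) (he : e ≤ Real.exp (-1)) :
    majorant e ≤ majorant d := by
  have h1 : Real.exp (-1) ≤ 1 := by simp
  have hd := majorant_pos h0 (by linarith)
  unfold majorant at hd ⊢
  exact inv_anti₀ (inv_pos.1 hd)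
    (monotoneOn_denominator ⟨h0, hde.trans he⟩ ⟨h0.trans_le hde, he⟩ hde)

lemma majorant_le_of_exp_le {d : ℝ} (h : Real.exp (-1) ≤ d) (h2 : d ≤ 2) : majorant d ≤ 40 := by
  have h0 : 0 < d := (Real.exp_pos _).trans_le h
  have h1 := profile_lower h0 h2
  have h3 := log_profile_lower h0 h2
  have h4 := Real.exp_neg_one_gt_d9
  unfold majorant
  rw [inv_le_comm₀ (inv_pos.1 (majorant_pos h0 h2)) (by norm_num)]
  calc (40 : ℝ)⁻¹ ≤ (36 / 100) * (3 / 10) * (1 / 2) ^ 2 := by norm_num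
    _ ≤ _ := by gcongr; linarith

lemma majorant_le_add {d e : ℝ} (h0 : 0 < d) (hde : d ≤ e) (he : e ≤ 2) :
    majorant e ≤ majorant d + 40 := by
  rcases le_total e (Real.exp (-1)) with h | h
  · linarith [majorant_antitone h0 hde h]
  · linarith [majorant_le_of_exp_le h he, majorant_pos h0 (hde.trans he)]

lemma continuousOn_majorant : ContinuousOn majorant (Ioc 0 2) := by
  intro d hd
  have h1 := profile_pos hd.1 hd.2
  have h3 := log_profile_pos hd.1 hd.2
  have h4 := (hasDerivAt_profile hd.1).continuousAt
  have h5 := (hasDerivAt_log_profile hd.1 hd.2).continuousAt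
  have h6 := hd.1
  apply ContinuousAt.continuousWithinAt
  exact ((continuousAt_id.mul h4).mul (h5.pow 2)).inv₀ (by simp only [id, Pi.mul_apply, Pi.pow_apply]; positivity)

lemma integral_majorant {a b : ℝ} (ha : 0 < a) (hab : a ≤ b) (hb : b ≤ 2) :
    ∫ d in a..b, majorant d =
      (Real.log (profile b) + 2)⁻¹ - (Real.log (profile a) + 2)⁻¹ := by
  apply intervalIntegral.integral_eq_sub_of_hasDerivAt
  · intro x hx
    rw [uIcc_of_le hab] at hx
    exact hasDerivAt_inv_log_profile (ha.trans_le hx.1) (hx.2.trans hb)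
  · apply ContinuousOn.intervalIntegrable
    rw [uIcc_of_le hab]
    exact continuousOn_majorant.mono fun x hx => ⟨ha.trans_le hx.1, hx.2.trans hb⟩

lemma intervalIntegrable_majorant : IntervalIntegrable majorant volume 0 1 := by
  rw [intervalIntegrable_iff_integrableOn_Ioc_of_le zero_le_one]
  have hu : Tendsto (fun n : ℕ => (1 : ℝ) / (n + 1)) atTop (𝓝 0) :=
    tendsto_one_div_add_atTop_nhds_zero_nat
  have h1 : ∀ n : ℕ, (1 : ℝ) / (n + 1) ≤ 1 := fun n => by
    rw [div_le_one (by positivity)]; linarith [n.cast_nonneg (α := ℝ)]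
  apply integrableOn_Ioc_of_intervalIntegral_norm_bounded_left
    (I := (Real.log (profile 1) + 2)⁻¹) (l := atTop)
    (a := fun n : ℕ => (1 : ℝ) / (n + 1)) _ hu
  · refine Eventually.of_forall fun n => ?_
    have hp : (0 : ℝ) < 1 / (n + 1) := by positivity
    rw [← intervalIntegral.integral_of_le (h1 n)]
    have : ∫ x in (1 : ℝ) / (n + 1)..1, ‖majorant x‖ = ∫ x in (1 : ℝ) / (n + 1)..1, majorant x := by
      apply intervalIntegral.integral_congr
      intro x hx
      rw [uIcc_of_le (h1 n)] at hx
      exact Real.norm_of_nonneg (majorant_pos (hp.trans_le hx.1) (by linarith [hx.2])).le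
    rw [this, integral_majorant hp (h1 n) (by norm_num)]
    have := log_profile_pos hp (by linarith [h1 n])
    have := inv_pos.2 this
    linarith
  · intro n
    have hp : (0 : ℝ) < 1 / (n + 1) := by positivity
    exact ((continuousOn_majorant.mono fun x hx =>
      ⟨hp.trans_le hx.1, by linarith [hx.2]⟩).integrableOn_Icc).mono_set Ioc_subset_Icc_self

lemma intervalIntegrable_majorant_angle :
    IntervalIntegrable (fun θ => majorant (|π - θ| / π)) volume 0 (2 * π) := by
  have hpi := Real.pi_pos
  have h1 : IntervalIntegrable (fun θ => majorant ((π - θ) / π)) volume 0 π := by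
    have := ((intervalIntegrable_majorant.comp_mul_right (c := π⁻¹)).comp_sub_left π).symm
    simpa [div_eq_mul_inv] using this
  have h2 : IntervalIntegrable (fun θ => majorant ((θ - π) / π)) volume π (2 * π) := by
    have := (intervalIntegrable_majorant.comp_mul_right (c := π⁻¹)).comp_sub_right π
    simpa [div_eq_mul_inv, two_mul] using this
  refine (h1.congr ?_).trans (h2.congr ?_)
  · intro θ hθ
    rw [uIoc_of_le hpi.le] at hθ
    simp only
    rw [abs_of_nonneg (by linarith [hθ.2])]
  · intro θ hθ
    rw [uIoc_of_le (by linarith)] at hθ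
    simp only
    rw [abs_of_nonpos (by linarith [hθ.1]), neg_sub]

/-- The test function as a function on the closed unit disc. -/
noncomputable def testExt (z : ℂ) : ℂ :=
  1 / ((1 + z) * (1 - Complex.log (1 + z)) * (Complex.log (1 - Complex.log (1 + z)) + 2) ^ 2)

lemma one_add_re_pos {z : ℂ} (hz : ‖z‖ ≤ 1) (h : z ≠ -1) : 0 < (1 + z).re := by
  have h1 : -1 ≤ z.re := (neg_le_of_abs_le (Complex.abs_re_le_norm z)).trans' (by linarith)
  rcases h1.eq_or_lt with h2 | h2
  · exfalso
    apply h
    have h3 : z.re * z.re + z.im * z.im ≤ 1 := by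
      rw [← Complex.normSq_apply, Complex.normSq_eq_norm_sq]
      nlinarith [norm_nonneg z]
    rw [← h2] at h3
    have h4 : z.im = 0 := by nlinarith [sq_nonneg z.im]
    exact Complex.ext (by simp [← h2]) (by simp [h4])
  · simp; linarith

lemma norm_one_add_le {z : ℂ} (hz : ‖z‖ ≤ 1) : ‖1 + z‖ ≤ 2 := by
  calc ‖1 + z‖ ≤ ‖(1 : ℂ)‖ + ‖z‖ := norm_add_le _ _
    _ ≤ 2 := by rw [norm_one]; linarith

lemma norm_one_add_pos {z : ℂ} (h : z ≠ -1) : 0 < ‖1 + z‖ := by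
  rw [norm_pos_iff]
  intro h0
  exact h (by linear_combination h0)

lemma one_sub_log_re (w : ℂ) : (1 - Complex.log w).re = profile ‖w‖ := by
  simp [profile, Complex.log_re]

lemma one_sub_log_re_lower {z : ℂ} (hz : ‖z‖ ≤ 1) (h : z ≠ -1) :
    3 / 10 ≤ (1 - Complex.log (1 + z)).re := by
  rw [one_sub_log_re]
  exact profile_lower (norm_one_add_pos h) (norm_one_add_le hz)

lemma log_profile_le_norm {z : ℂ} (hz : ‖z‖ ≤ 1) (h : z ≠ -1) :
    Real.log (profile ‖1 + z‖) + 2 ≤ ‖Complex.log (1 - Complex.log (1 + z)) + 2‖ := by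
  refine le_trans ?_ (Complex.re_le_norm _)
  rw [Complex.add_re, Complex.log_re]
  have h1 : profile ‖1 + z‖ ≤ ‖1 - Complex.log (1 + z)‖ := by
    rw [← one_sub_log_re]; exact Complex.re_le_norm _
  have := Real.log_le_log (profile_pos (norm_one_add_pos h) (norm_one_add_le hz)) h1
  simpa using this

lemma norm_testExt_le {z : ℂ} (hz : ‖z‖ ≤ 1) (h : z ≠ -1) :
    ‖testExt z‖ ≤ majorant ‖1 + z‖ := by
  have h0 := norm_one_add_pos h
  have h2 := norm_one_add_le hz
  have h1 : profile ‖1 + z‖ ≤ ‖1 - Complex.log (1 + z)‖ := by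
    rw [← one_sub_log_re]; exact Complex.re_le_norm _
  have h3 := log_profile_le_norm hz h
  have h4 := profile_pos h0 h2
  have h5 := log_profile_pos h0 h2
  unfold testExt majorant
  rw [norm_div, norm_one, norm_mul, norm_mul, norm_pow, one_div]
  gcongr

lemma differentiableAt_testExt {z : ℂ} (hz : ‖z‖ ≤ 1) (h : z ≠ -1) :
    DifferentiableAt ℂ testExt z := by
  have h1 := one_add_re_pos hz h
  have h2 := one_sub_log_re_lower hz h
  have h3 := log_profile_le_norm hz h
  have h4 := log_profile_pos (norm_one_add_pos h) (norm_one_add_le hz)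
  have hs : 1 + z ∈ Complex.slitPlane := Or.inl h1
  have hs' : 1 - Complex.log (1 + z) ∈ Complex.slitPlane := Or.inl (by linarith)
  have d1 : DifferentiableAt ℂ (fun z : ℂ => 1 - Complex.log (1 + z)) z :=
    (DifferentiableAt.clog (by fun_prop) hs).const_sub 1
  have d2 : DifferentiableAt ℂ (fun z : ℂ => Complex.log (1 - Complex.log (1 + z)) + 2) z :=
    (d1.clog hs').add_const 2
  unfold testExt
  refine (differentiableAt_const _).fun_div
    (((differentiableAt_id.const_add 1).fun_mul d1).fun_mul (d2.fun_pow 2)) ?_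
  refine mul_ne_zero (mul_ne_zero (Complex.slitPlane_ne_zero hs)
    (Complex.slitPlane_ne_zero hs')) (pow_ne_zero 2 ?_)
  rw [← norm_pos_iff]
  linarith

lemma testExt_neg_ofReal {x : ℝ} (h0 : 0 ≤ x) (h1 : x < 1) :
    testExt (-x) = majorant (1 - x) := by
  have hp := profile_pos (d := 1 - x) (by linarith) (by linarith)
  unfold testExt majorant
  have e1 : (1 : ℂ) + -x = ((1 - x : ℝ) : ℂ) := by push_cast; ring
  have e2 : 1 - Complex.log ((1 - x : ℝ) : ℂ) = (profile (1 - x) : ℂ) := by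
    rw [← Complex.ofReal_log (by linarith)]; simp [profile]
  rw [e1, e2, ← Complex.ofReal_log hp.le]
  push_cast
  rw [one_div]

/-- The point `e^{iθ}` of the unit circle. -/
noncomputable def circlePt (θ : ℝ) : ℂ := Complex.exp (θ * Complex.I)

@[fun_prop]
lemma continuous_circlePt : Continuous circlePt := by
  unfold circlePt; fun_prop

lemma norm_circlePt (θ : ℝ) : ‖circlePt θ‖ = 1 := Complex.norm_exp_ofReal_mul_I θ

lemma circlePt_ne_zero (θ : ℝ) : circlePt θ ≠ 0 := Complex.exp_ne_zero _

lemma exp_neg_eq_inv (θ : ℝ) : Complex.exp (-(θ : ℂ) * Complex.I) = (circlePt θ)⁻¹ := by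
  rw [circlePt, ← Complex.exp_neg, neg_mul]

lemma inv_circlePt (θ : ℝ) : (circlePt θ)⁻¹ = (starRingEnd ℂ) (circlePt θ) := by
  rw [Complex.inv_eq_conj (norm_circlePt θ)]

lemma exp_fourier (n : ℤ) (θ : ℝ) :
    Complex.exp (-(n : ℂ) * (θ : ℂ) * Complex.I) = circlePt θ ^ (-n) := by
  rw [circlePt, ← Complex.exp_int_mul]
  congr 1
  push_cast
  ring

lemma norm_one_add_mul_ge {z : ℂ} (hz : ‖z‖ ≤ 1) {ρ : ℝ} (h0 : 0 ≤ ρ) (h1 : ρ ≤ 1) :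
    ρ * ‖1 + z‖ ≤ ‖1 + ρ * z‖ := by
  have hre : 0 ≤ 1 + z.re := by
    have := neg_le_of_abs_le (Complex.abs_re_le_norm z)
    linarith
  rw [← sq_le_sq₀ (by positivity) (by positivity), mul_pow, ← Complex.normSq_eq_norm_sq,
    ← Complex.normSq_eq_norm_sq, Complex.normSq_apply, Complex.normSq_apply]
  simp only [Complex.add_re, Complex.one_re, Complex.add_im, Complex.one_im, Complex.mul_re,
    Complex.mul_im, Complex.ofReal_re, Complex.ofReal_im]
  nlinarith [mul_nonneg (mul_nonneg h0 hre) (sub_nonneg.2 h1), sq_nonneg (1 - ρ)]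

lemma abs_pi_sub_div_le {θ : ℝ} (h0 : 0 ≤ θ) (h1 : θ ≤ 2 * π) :
    |π - θ| / π ≤ ‖1 + circlePt θ‖ / 2 := by
  have hpi := Real.pi_pos
  have h2 : |(π - θ) / 2| ≤ π / 2 := by
    rw [abs_le]; constructor <;> linarith
  have h3 := Real.mul_abs_le_abs_sin h2
  have h4 : Real.sin ((π - θ) / 2) = Real.cos (θ / 2) := by
    rw [← Real.sin_pi_div_two_sub]; congr 1; ring
  have h5 : ‖1 + circlePt θ‖ ^ 2 = (2 * |Real.cos (θ / 2)|) ^ 2 := by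
    rw [← Complex.normSq_eq_norm_sq, Complex.normSq_apply, mul_pow, sq_abs, Real.cos_sq, circlePt]
    simp only [Complex.add_re, Complex.one_re, Complex.add_im, Complex.one_im,
      Complex.exp_ofReal_mul_I_re, Complex.exp_ofReal_mul_I_im]
    rw [mul_div_cancel₀ _ (two_ne_zero' ℝ)]
    linear_combination Real.sin_sq_add_cos_sq θ
  rw [sq_eq_sq₀ (by positivity) (by positivity)] at h5
  rw [h4, abs_div, abs_of_pos (two_pos : (0 : ℝ) < 2)] at h3
  rw [h5, mul_div_cancel_left₀ _ (two_ne_zero' ℝ)]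
  calc |π - θ| / π = 2 / π * (|π - θ| / 2) := by field_simp
    _ ≤ _ := h3

lemma circlePt_eq_neg_one {θ : ℝ} (h0 : 0 ≤ θ) (h1 : θ ≤ 2 * π) (h : circlePt θ = -1) :
    θ = π := by
  have h2 := abs_pi_sub_div_le h0 h1
  have hpi := Real.pi_pos
  rw [h] at h2
  simp only [add_neg_cancel, norm_zero, zero_div] at h2
  have h3 : |π - θ| ≤ 0 := by
    by_contra! h4
    exact absurd h2 (not_le.2 (by positivity))
  have := abs_nonpos_iff.1 h3
  linarith

lemma norm_testExt_circle_le {θ ρ : ℝ} (h0 : 0 ≤ θ) (h1 : θ ≤ 2 * π) (hθ : θ ≠ π)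
    (hρ : 1 / 2 ≤ ρ) (hρ1 : ρ ≤ 1) :
    ‖testExt (ρ * circlePt θ)‖ ≤ majorant (|π - θ| / π) + 40 := by
  have hpi := Real.pi_pos
  have hn : ‖(ρ : ℂ) * circlePt θ‖ ≤ 1 := by
    rw [norm_mul, norm_circlePt, Complex.norm_real, Real.norm_of_nonneg (by linarith)]
    linarith
  have hpos : 0 < |π - θ| / π := div_pos (abs_pos.2 (sub_ne_zero.2 hθ.symm)) hpi
  have h2 : |π - θ| / π ≤ ‖1 + ρ * circlePt θ‖ := by
    refine (abs_pi_sub_div_le h0 h1).trans ?_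
    refine le_trans ?_ (norm_one_add_mul_ge (norm_circlePt θ).le (by linarith) hρ1)
    nlinarith [norm_nonneg (1 + circlePt θ)]
  have hne : (ρ : ℂ) * circlePt θ ≠ -1 := by
    intro h
    rw [h] at h2
    simp at h2
    linarith
  exact (norm_testExt_le hn hne).trans (majorant_le_add hpos h2 (norm_one_add_le hn))

lemma ae_ne_pi : ∀ᵐ θ : ℝ, θ ≠ π := by
  rw [ae_iff]
  simp

@[fun_prop]
lemma measurable_testExt : Measurable testExt := by
  unfold testExt
  fun_prop

lemma intervalIntegrable_testExt_bound (C : ℝ) :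
    IntervalIntegrable (fun θ => (majorant (|π - θ| / π) + 40) * C) volume 0 (2 * π) :=
  (intervalIntegrable_majorant_angle.add intervalIntegrable_const).mul_const C

lemma intervalIntegrable_testExt :
    IntervalIntegrable (fun θ => testExt (circlePt θ)) volume 0 (2 * π) := by
  refine (intervalIntegrable_testExt_bound 1).mono_fun ?_ ?_
  · exact (measurable_testExt.comp continuous_circlePt.measurable).aestronglyMeasurable
  · refine (ae_restrict_iff' measurableSet_uIoc).2 ?_
    filter_upwards [ae_ne_pi] with θ hθ hm
    rw [uIoc_of_le (by positivity)] at hm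
    have := norm_testExt_circle_le (ρ := 1) hm.1.le hm.2 hθ (by norm_num) le_rfl
    simp only [Complex.ofReal_one, one_mul] at this
    rw [mul_one]
    exact this.trans (le_abs_self _)

lemma tendsto_integral_testExt {ψ : ℝ → ℂ} (hψ : Continuous ψ) {C : ℝ} (hC : ∀ θ, ‖ψ θ‖ ≤ C) :
    Tendsto (fun ρ : ℝ => ∫ θ in (0 : ℝ)..(2 * π), testExt (ρ * circlePt θ) * ψ θ) (𝓝[<] 1)
      (𝓝 (∫ θ in (0 : ℝ)..(2 * π), testExt (circlePt θ) * ψ θ)) := by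
  refine intervalIntegral.tendsto_integral_filter_of_dominated_convergence
    (fun θ => (majorant (|π - θ| / π) + 40) * C) ?_ ?_ (intervalIntegrable_testExt_bound C) ?_
  · refine Eventually.of_forall fun ρ => Measurable.aestronglyMeasurable ?_
    have := continuous_circlePt.measurable
    have := hψ.measurable
    fun_prop
  · have h : ∀ᶠ ρ : ℝ in 𝓝[<] 1, ρ ∈ Ioo (1 / 2 : ℝ) 1 := Ioo_mem_nhdsLT (by norm_num)
    filter_upwards [h] with ρ hρ
    filter_upwards [ae_ne_pi] with θ hθ hm
    rw [uIoc_of_le (by positivity)] at hm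
    have h1 := norm_testExt_circle_le hm.1.le hm.2 hθ hρ.1.le hρ.2.le
    rw [norm_mul]
    exact mul_le_mul h1 (hC θ) (norm_nonneg _) ((norm_nonneg _).trans h1)
  · filter_upwards [ae_ne_pi] with θ hθ hm
    rw [uIoc_of_le (by positivity)] at hm
    have hne : circlePt θ ≠ -1 := fun h => hθ (circlePt_eq_neg_one hm.1.le hm.2 h)
    have hc := (differentiableAt_testExt (norm_circlePt θ).le hne).continuousAt
    refine Tendsto.mul_const _ ?_
    have h1 : Tendsto (fun ρ : ℝ => (ρ : ℂ) * circlePt θ) (𝓝[<] 1) (𝓝 (circlePt θ)) := by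
      have : Continuous fun ρ : ℝ => (ρ : ℂ) * circlePt θ := by fun_prop
      simpa using (this.tendsto 1).mono_left nhdsWithin_le_nhds
    exact hc.tendsto.comp h1

lemma diffContOnCl_testExt_dilate {ρ : ℝ} (h0 : 0 ≤ ρ) (h1 : ρ < 1) :
    DiffContOnCl ℂ (fun z : ℂ => testExt (ρ * z)) (Metric.ball 0 |1|) := by
  refine DifferentiableOn.diffContOnCl fun z hz => ?_
  rw [abs_one, closure_ball _ one_ne_zero, mem_closedBall_zero_iff] at hz
  have hn : ‖(ρ : ℂ) * z‖ < 1 := by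
    rw [norm_mul, Complex.norm_real, Real.norm_of_nonneg h0]
    nlinarith [norm_nonneg z]
  have hne : (ρ : ℂ) * z ≠ -1 := by
    intro h
    rw [h] at hn
    simp at hn
  have hd := differentiableAt_testExt hn.le hne
  exact (hd.comp z (f := fun z : ℂ => (ρ : ℂ) * z) (by fun_prop)).differentiableWithinAt

lemma circleAverage_eq_integral (F : ℂ → ℂ) :
    circleAverage F 0 1 = (1 / (2 * (π : ℂ))) * ∫ θ in (0 : ℝ)..(2 * π), F (circlePt θ) := by
  simp [circleAverage, circleMap, circlePt]

lemma testExt_fourier_neg (n : ℕ) (hn : n ≠ 0) :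
    (1 / (2 * (π : ℂ))) * ∫ θ in (0 : ℝ)..(2 * π), testExt (circlePt θ) * circlePt θ ^ n = 0 := by
  have h := (tendsto_integral_testExt (ψ := fun θ => circlePt θ ^ n) (by fun_prop) (C := 1)
    (fun θ => by simp [norm_circlePt])).const_mul (1 / (2 * (π : ℂ)))
  refine tendsto_nhds_unique h (tendsto_const_nhds.congr' ?_)
  have hρ : ∀ᶠ ρ : ℝ in 𝓝[<] 1, ρ ∈ Ioo (0 : ℝ) 1 := Ioo_mem_nhdsLT (by norm_num)
  filter_upwards [hρ] with ρ hρ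
  have hd : DiffContOnCl ℂ (fun z : ℂ => testExt (ρ * z) • z ^ n) (Metric.ball 0 |1|) :=
    (diffContOnCl_testExt_dilate hρ.1.le hρ.2).smul
      (Differentiable.diffContOnCl (by fun_prop))
  have := hd.circleAverage
  rw [circleAverage_eq_integral] at this
  simpa [hn] using this.symm

lemma norm_one_add_mul_lower {x : ℝ} (h0 : 0 ≤ x) {w : ℂ} (hw : ‖w‖ = 1) :
    1 - x ≤ ‖1 + x * w‖ := by
  have h := norm_sub_norm_le (1 : ℂ) (-(x * w))
  rw [norm_neg, norm_mul, hw, Complex.norm_real, Real.norm_of_nonneg h0, norm_one,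
    sub_neg_eq_add] at h
  linarith

lemma one_add_mul_ne_zero {x : ℝ} (h0 : 0 ≤ x) (h1 : x < 1) {w : ℂ} (hw : ‖w‖ = 1) :
    1 + x * w ≠ 0 := by
  rw [← norm_pos_iff]
  linarith [norm_one_add_mul_lower h0 hw]

lemma testExt_cauchy {x : ℝ} (h0 : 0 ≤ x) (h1 : x < 1) :
    (1 / (2 * (π : ℂ))) * ∫ θ in (0 : ℝ)..(2 * π),
      testExt (circlePt θ) * (1 + x * (circlePt θ)⁻¹)⁻¹ = majorant (1 - x) := by
  have hinv : ∀ θ, ‖(circlePt θ)⁻¹‖ = 1 := fun θ => by rw [norm_inv, norm_circlePt, inv_one]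
  have hcont : Continuous fun θ => (1 + x * (circlePt θ)⁻¹)⁻¹ :=
    Continuous.inv₀ (by
      have : Continuous fun θ => (circlePt θ)⁻¹ := continuous_circlePt.inv₀ circlePt_ne_zero
      fun_prop) fun θ => one_add_mul_ne_zero h0 h1 (hinv θ)
  have h := (tendsto_integral_testExt hcont (C := (1 - x)⁻¹) (fun θ => by
    rw [norm_inv]
    exact inv_anti₀ (by linarith) (norm_one_add_mul_lower h0 (hinv θ)))).const_mul
      (1 / (2 * (π : ℂ)))
  rw [← testExt_neg_ofReal h0 h1]
  have hlim : Tendsto (fun ρ : ℝ => testExt (ρ * (-x : ℂ))) (𝓝[<] 1) (𝓝 (testExt (-x))) := by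
    have hn : ‖(-x : ℂ)‖ < 1 := by
      rwa [norm_neg, Complex.norm_real, Real.norm_of_nonneg h0]
    have hc := (differentiableAt_testExt hn.le (fun h => by simp [h] at hn)).continuousAt
    have h1 : Tendsto (fun ρ : ℝ => (ρ : ℂ) * (-x : ℂ)) (𝓝[<] 1) (𝓝 (-x : ℂ)) := by
      have : Continuous fun ρ : ℝ => (ρ : ℂ) * (-x : ℂ) := by fun_prop
      simpa using (this.tendsto 1).mono_left nhdsWithin_le_nhds
    exact hc.tendsto.comp h1
  refine tendsto_nhds_unique h (hlim.congr' ?_)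
  have hρ : ∀ᶠ ρ : ℝ in 𝓝[<] 1, ρ ∈ Ioo (0 : ℝ) 1 := Ioo_mem_nhdsLT (by norm_num)
  filter_upwards [hρ] with ρ hρ
  have hw : (-x : ℂ) ∈ Metric.ball (0 : ℂ) |1| := by
    rw [abs_one, mem_ball_zero_iff, norm_neg, Complex.norm_real, Real.norm_of_nonneg h0]
    exact h1
  have := (diffContOnCl_testExt_dilate hρ.1.le hρ.2).circleAverage_smul_div hw
  rw [circleAverage_eq_integral] at this
  rw [← this]
  congr 1
  apply intervalIntegral.integral_congr
  intro θ _
  have h3 := circlePt_ne_zero θ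
  have h4 := one_add_mul_ne_zero h0 h1 (hinv θ)
  have h5 : circlePt θ - -x ≠ 0 := by
    intro h6
    apply h4
    field_simp
    linear_combination h6
  simp only [sub_zero, smul_eq_mul]
  have h6 : 1 + (x : ℂ) * (circlePt θ)⁻¹ = (circlePt θ - -x) / circlePt θ := by
    field_simp; ring
  rw [h6, inv_div, mul_comm]

/-- Pairing an integrable function all of whose moments against powers of a unimodular function
vanish with a function holomorphic beyond the closed unit disc. -/
lemma integral_mul_comp_eq_zero {m : ℝ → ℂ} (hm : IntervalIntegrable m volume 0 (2 * π))
    {ζ : ℝ → ℂ} (hζ : Continuous ζ) (hζ1 : ∀ θ, ‖ζ θ‖ = 1)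
    (h : ∀ n : ℕ, ∫ θ in (0 : ℝ)..(2 * π), m θ * ζ θ ^ n = 0)
    {φ : ℂ → ℂ} {R : NNReal} (hR : 1 < R) (hφ : DifferentiableOn ℂ φ (Metric.ball 0 R)) :
    ∫ θ in (0 : ℝ)..(2 * π), m θ * φ (ζ θ) = 0 := by
  obtain ⟨r, hr1, hrR⟩ := exists_between hR
  have hr0 : 0 < r := zero_lt_one.trans hr1
  have hp := (hφ.mono (Metric.closedBall_subset_ball
    (NNReal.coe_lt_coe.2 hrR))).hasFPowerSeriesOnBall hr0
  set p := cauchyPowerSeries φ 0 r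
  have hsum : Summable fun n => ‖p n‖ := by
    have := p.summable_norm_mul_pow (r := 1)
      (lt_of_lt_of_le (by exact_mod_cast hr1) hp.r_le)
    simpa using this
  have hs : ∀ w : ℂ, ‖w‖ = 1 → HasSum (fun n => w ^ n * p.coeff n) (φ w) := by
    intro w hw
    have := hp.hasSum (y := w) (by
      rw [Metric.mem_eball, edist_zero_right, enorm_eq_nnnorm]
      have : ‖w‖₊ = 1 := by ext; exact hw
      rw [this]; exact_mod_cast hr1)
    simpa [FormalMultilinearSeries.apply_eq_pow_smul_coeff] using this
  have key : HasSum (fun n => ∫ θ in (0 : ℝ)..(2 * π), m θ * (ζ θ ^ n * p.coeff n))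
      (∫ θ in (0 : ℝ)..(2 * π), m θ * φ (ζ θ)) := by
    refine intervalIntegral.hasSum_integral_of_dominated_convergence
      (fun n θ => ‖m θ‖ * ‖p n‖) ?_ ?_ ?_ ?_ ?_
    · intro n
      refine hm.def'.aestronglyMeasurable.mul ?_
      exact Continuous.aestronglyMeasurable (by fun_prop)
    · intro n
      refine Eventually.of_forall fun θ _ => ?_
      rw [norm_mul, norm_mul, norm_pow, hζ1, one_pow, one_mul, ← p.norm_apply_eq_norm_coef]
    · exact Eventually.of_forall fun θ _ => hsum.mul_left _
    · simp_rw [tsum_mul_left]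
      exact hm.norm.mul_const _
    · exact Eventually.of_forall fun θ _ => (hs _ (hζ1 θ)).mul_left _
  have hz : ∀ n, ∫ θ in (0 : ℝ)..(2 * π), m θ * (ζ θ ^ n * p.coeff n) = 0 := by
    intro n
    simp_rw [← mul_assoc]
    rw [intervalIntegral.integral_mul_const, h n, zero_mul]
  simp_rw [hz] at key
  exact key.unique hasSum_zero

/-- The outer function `1 - Log (1 + s w)`, holomorphic beyond the closed disc for `s < 1`. -/
noncomputable def dilatedLog (s : ℝ) (w : ℂ) : ℂ := 1 - Complex.log (1 + s * w)

lemma norm_inv_circlePt (θ : ℝ) : ‖(circlePt θ)⁻¹‖ = 1 := by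
  rw [norm_inv, norm_circlePt, inv_one]

@[fun_prop]
lemma continuous_inv_circlePt : Continuous fun θ => (circlePt θ)⁻¹ :=
  continuous_circlePt.inv₀ circlePt_ne_zero

lemma norm_inv_one_add_mul_le {x : ℝ} (h0 : 0 ≤ x) (h1 : x < 1) {w : ℂ} (hw : ‖w‖ = 1) :
    ‖(1 + x * w)⁻¹‖ ≤ (1 - x)⁻¹ := by
  rw [norm_inv]
  exact inv_anti₀ (by linarith) (norm_one_add_mul_lower h0 hw)

lemma dilatedLog_eq_integral {s : ℝ} (h0 : 0 ≤ s) (h1 : s < 1) {w : ℂ} (hw : ‖w‖ = 1) :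
    dilatedLog s w = 1 - ∫ τ in (0 : ℝ)..s, w * (1 + τ * w)⁻¹ := by
  have hd : ∀ τ ∈ uIcc 0 s, HasDerivAt (fun τ : ℝ => Complex.log (1 + τ * w))
      (w * (1 + τ * w)⁻¹) τ := by
    intro τ hτ
    rw [uIcc_of_le h0] at hτ
    have hm : 1 + (τ : ℂ) * w ∈ Complex.slitPlane := by
      apply Complex.mem_slitPlane_of_norm_lt_one
      rw [norm_mul, hw, Complex.norm_real, Real.norm_of_nonneg hτ.1]
      linarith [hτ.2]
    have h2 : HasDerivAt (fun τ : ℝ => 1 + (τ : ℂ) * w) w τ := by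
      simpa using ((Complex.ofRealCLM.hasDerivAt (x := τ)).mul_const w).const_add 1
    simpa [div_eq_mul_inv] using h2.clog_real hm
  rw [intervalIntegral.integral_eq_sub_of_hasDerivAt hd]
  · simp [dilatedLog]
  · apply ContinuousOn.intervalIntegrable
    intro τ hτ
    rw [uIcc_of_le h0] at hτ
    apply ContinuousAt.continuousWithinAt
    have := one_add_mul_ne_zero hτ.1 (by linarith [hτ.2]) hw
    fun_prop (disch := assumption)

/-- The pairing of the test function with a difference quotient of Cauchy kernels. -/
noncomputable def cauchyPairing (x τ : ℝ) : ℂ :=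
  (1 / (2 * (π : ℂ))) * ∫ θ in (0 : ℝ)..(2 * π), testExt (circlePt θ) *
    ((circlePt θ)⁻¹ * (1 + τ * (circlePt θ)⁻¹)⁻¹ * (1 + x * (circlePt θ)⁻¹)⁻¹)

lemma intervalIntegrable_testExt_mul {ψ : ℝ → ℂ} (hψ : Continuous ψ) :
    IntervalIntegrable (fun θ => testExt (circlePt θ) * ψ θ) volume 0 (2 * π) :=
  intervalIntegrable_testExt.mul_continuousOn hψ.continuousOn

lemma continuous_cauchyKernel {x : ℝ} (h0 : 0 ≤ x) (h1 : x < 1) :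
    Continuous fun θ => (1 + x * (circlePt θ)⁻¹)⁻¹ :=
  Continuous.inv₀ (by fun_prop) fun θ => one_add_mul_ne_zero h0 h1 (norm_inv_circlePt θ)

lemma cauchyPairing_eq {x τ : ℝ} (hx0 : 0 ≤ x) (hx1 : x < 1) (hτ0 : 0 ≤ τ) (hτ1 : τ < 1)
    (hne : τ ≠ x) :
    cauchyPairing x τ = (((majorant (1 - x) - majorant (1 - τ)) / (τ - x) : ℝ) : ℂ) := by
  have hsub : (τ : ℂ) - x ≠ 0 := by
    rw [← Complex.ofReal_sub]; exact_mod_cast sub_ne_zero.2 hne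
  have key : ∀ θ, testExt (circlePt θ) *
      ((circlePt θ)⁻¹ * (1 + τ * (circlePt θ)⁻¹)⁻¹ * (1 + x * (circlePt θ)⁻¹)⁻¹) =
      (testExt (circlePt θ) * (1 + x * (circlePt θ)⁻¹)⁻¹ -
        testExt (circlePt θ) * (1 + τ * (circlePt θ)⁻¹)⁻¹) * ((τ : ℂ) - x)⁻¹ := by
    intro θ
    have h1 := one_add_mul_ne_zero hx0 hx1 (norm_inv_circlePt θ)
    have h2 := one_add_mul_ne_zero hτ0 hτ1 (norm_inv_circlePt θ)
    have e : (1 + x * (circlePt θ)⁻¹)⁻¹ - (1 + τ * (circlePt θ)⁻¹)⁻¹ = ((τ : ℂ) - x) *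
        ((circlePt θ)⁻¹ * (1 + τ * (circlePt θ)⁻¹)⁻¹ * (1 + x * (circlePt θ)⁻¹)⁻¹) := by
      rw [inv_sub_inv h1 h2, div_eq_mul_inv, mul_inv]
      ring
    rw [← mul_sub, e]
    field_simp
  unfold cauchyPairing
  simp_rw [key]
  rw [intervalIntegral.integral_mul_const, intervalIntegral.integral_sub
    (intervalIntegrable_testExt_mul (continuous_cauchyKernel hx0 hx1))
    (intervalIntegrable_testExt_mul (continuous_cauchyKernel hτ0 hτ1)),
    ← mul_assoc, mul_sub, testExt_cauchy hx0 hx1, testExt_cauchy hτ0 hτ1]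
  push_cast
  rw [div_eq_mul_inv]

lemma integrable_cauchyKernel_prod {x s : ℝ} (hx0 : 0 ≤ x) (hx1 : x < 1) (hs0 : 0 ≤ s)
    (hs1 : s < 1) :
    Integrable (Function.uncurry fun τ θ : ℝ => testExt (circlePt θ) *
      ((circlePt θ)⁻¹ * (1 + τ * (circlePt θ)⁻¹)⁻¹ * (1 + x * (circlePt θ)⁻¹)⁻¹))
      ((volume.restrict (uIoc 0 s)).prod (volume.restrict (uIoc 0 (2 * π)))) := by
  have : IsFiniteMeasure ((volume : Measure ℝ).restrict (uIoc 0 s)) := by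
    rw [uIoc_of_le hs0]; infer_instance
  have hg := (intervalIntegrable_testExt.def').comp_snd (volume.restrict (uIoc 0 s))
  refine hg.mul_bdd (c := 1 * (1 - s)⁻¹ * (1 - x)⁻¹) ?_ ?_
  · refine Measurable.aestronglyMeasurable ?_
    have := continuous_inv_circlePt.measurable
    fun_prop
  · have hm : ∀ᵐ p : ℝ × ℝ ∂((volume.restrict (uIoc 0 s)).prod
        (volume.restrict (uIoc 0 (2 * π)))), p ∈ uIoc 0 s ×ˢ uIoc 0 (2 * π) := by
      rw [Measure.prod_restrict]
      exact ae_restrict_mem (measurableSet_uIoc.prod measurableSet_uIoc)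
    filter_upwards [hm] with p hp
    have hp1 := hp.1
    rw [uIoc_of_le hs0] at hp1
    have hn := norm_inv_circlePt p.2
    have h1 := norm_inv_one_add_mul_le hx0 hx1 hn
    have h2 := norm_inv_one_add_mul_le hp1.1.le (hp1.2.trans_lt hs1) hn
    have h3 : (1 - p.1)⁻¹ ≤ (1 - s)⁻¹ := inv_anti₀ (by linarith) (by linarith [hp1.2])
    rw [norm_mul, norm_mul, hn]
    have : 0 ≤ (1 - s)⁻¹ := inv_nonneg.2 (by linarith)
    gcongr
    exact h2.trans h3

lemma intervalIntegrable_cauchyPairing {x s : ℝ} (hx0 : 0 ≤ x) (hx1 : x < 1) (hs0 : 0 ≤ s)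
    (hs1 : s < 1) : IntervalIntegrable (cauchyPairing x) volume 0 s := by
  rw [intervalIntegrable_iff]
  have h := (integrable_cauchyKernel_prod hx0 hx1 hs0 hs1).integral_prod_left.const_mul
    (1 / (2 * (π : ℂ)))
  refine h.congr (Eventually.of_forall fun τ => ?_)
  simp only [Function.uncurry, cauchyPairing]
  rw [intervalIntegral.integral_of_le (by positivity), uIoc_of_le (by positivity)]

/-- The pairing of the test function with the dilated logarithm times a Cauchy kernel. -/
noncomputable def logPairing (s x : ℝ) : ℂ :=
  (1 / (2 * (π : ℂ))) * ∫ θ in (0 : ℝ)..(2 * π), testExt (circlePt θ) *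
    (dilatedLog s (circlePt θ)⁻¹ * (1 + x * (circlePt θ)⁻¹)⁻¹)

lemma logPairing_eq {x s : ℝ} (hx0 : 0 ≤ x) (hx1 : x < 1) (hs0 : 0 ≤ s) (hs1 : s < 1) :
    logPairing s x = majorant (1 - x) - ∫ τ in (0 : ℝ)..s, cauchyPairing x τ := by
  have hprod := integrable_cauchyKernel_prod hx0 hx1 hs0 hs1
  have hswap := intervalIntegral_intervalIntegral_swap (a := 0) (b := s) (c := 0) (d := 2 * π)
    (F := fun τ θ : ℝ => testExt (circlePt θ) *
      ((circlePt θ)⁻¹ * (1 + τ * (circlePt θ)⁻¹)⁻¹ * (1 + x * (circlePt θ)⁻¹)⁻¹))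
    (by rwa [IntegrableOn, Measure.volume_eq_prod, ← Measure.prod_restrict])
  have key : ∀ θ, testExt (circlePt θ) *
      (dilatedLog s (circlePt θ)⁻¹ * (1 + x * (circlePt θ)⁻¹)⁻¹) =
      testExt (circlePt θ) * (1 + x * (circlePt θ)⁻¹)⁻¹ -
      ∫ τ in (0 : ℝ)..s, testExt (circlePt θ) *
      ((circlePt θ)⁻¹ * (1 + τ * (circlePt θ)⁻¹)⁻¹ * (1 + x * (circlePt θ)⁻¹)⁻¹) := by
    intro θ
    rw [intervalIntegral.integral_const_mul, intervalIntegral.integral_mul_const,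
      dilatedLog_eq_integral hs0 hs1 (norm_inv_circlePt θ)]
    ring
  have hint : IntervalIntegrable (fun θ => ∫ τ in (0 : ℝ)..s, testExt (circlePt θ) *
      ((circlePt θ)⁻¹ * (1 + τ * (circlePt θ)⁻¹)⁻¹ * (1 + x * (circlePt θ)⁻¹)⁻¹))
      volume 0 (2 * π) := by
    rw [intervalIntegrable_iff]
    refine hprod.integral_prod_right.congr (Eventually.of_forall fun θ => ?_)
    simp only [Function.uncurry]
    rw [intervalIntegral.integral_of_le hs0, uIoc_of_le hs0]
  unfold logPairing cauchyPairing
  simp_rw [key]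
  rw [intervalIntegral.integral_sub
    (intervalIntegrable_testExt_mul (continuous_cauchyKernel hx0 hx1)) hint, mul_sub,
    testExt_cauchy hx0 hx1, intervalIntegral.integral_const_mul, hswap]

lemma integral_majorant_reflect {x s : ℝ} (hx : 0 ≤ x) (hxs : x ≤ s) (hs : s < 1) :
    ∫ τ in x..s, majorant (1 - τ) =
      (Real.log (profile (1 - x)) + 2)⁻¹ - (Real.log (profile (1 - s)) + 2)⁻¹ := by
  rw [intervalIntegral.integral_comp_sub_left (fun d => majorant d),
    integral_majorant (by linarith) (by linarith) (by linarith)]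

lemma logPairing_lower {x s : ℝ} (hx : 9 / 10 ≤ x) (hxs : x < s) (hs : s < 1) :
    (1 - x)⁻¹ * ((Real.log (profile (1 - x)) + 2)⁻¹ - (Real.log (profile (1 - s)) + 2)⁻¹) - 160
      ≤ ‖logPairing s x‖ := by
  have hx0 : 0 ≤ x := by linarith
  have hx1 : x < 1 := by linarith
  have hs0 : 0 ≤ s := by linarith
  have hmx := (majorant_pos (d := 1 - x) (by linarith) (by linarith)).le
  have hI := intervalIntegrable_cauchyPairing hx0 hx1 hs0 hs
  have hqr : IntervalIntegrable (fun τ => (cauchyPairing x τ).re) volume 0 s :=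
    ⟨hI.1.re, hI.2.re⟩
  have hq : IntervalIntegrable (fun τ => -(cauchyPairing x τ).re) volume 0 s := hqr.neg
  have hre : (logPairing s x).re =
      majorant (1 - x) + ∫ τ in (0 : ℝ)..s, -(cauchyPairing x τ).re := by
    rw [logPairing_eq hx0 hx1 hs0 hs, Complex.sub_re, Complex.ofReal_re,
      intervalIntegral.integral_neg, sub_eq_add_neg]
    congr 2
    exact (Complex.reCLM.intervalIntegral_comp_comm hI).symm
  have hval : ∀ τ, 0 ≤ τ → τ < 1 → τ ≠ x → -(cauchyPairing x τ).re =
      (majorant (1 - τ) - majorant (1 - x)) / (τ - x) := by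
    intro τ h0 h1 hne
    rw [cauchyPairing_eq hx0 hx1 h0 h1 hne, Complex.ofReal_re, ← neg_div, neg_sub]
  have he1 := Real.exp_neg_one_gt_d9
  have hq1 : IntervalIntegrable (fun τ => -(cauchyPairing x τ).re) volume 0 x :=
    hq.mono_set (uIcc_subset_uIcc left_mem_uIcc (by rw [uIcc_of_le hs0]; exact ⟨hx0, hxs.le⟩))
  have hq2 : IntervalIntegrable (fun τ => -(cauchyPairing x τ).re) volume x s :=
    hq.mono_set (uIcc_subset_uIcc (by rw [uIcc_of_le hs0]; exact ⟨hx0, hxs.le⟩) right_mem_uIcc)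
  have hL : -160 ≤ ∫ τ in (0 : ℝ)..x, -(cauchyPairing x τ).re := by
    have hmono := intervalIntegral.integral_mono_on_of_le_Ioo hx0
      (intervalIntegrable_const (c := (-160 : ℝ))) hq1 (fun τ hτ => by
        rw [hval τ hτ.1.le (by linarith [hτ.2]) hτ.2.ne]
        rcases le_total (1 - τ) (Real.exp (-1)) with h | h
        · have := majorant_antitone (d := 1 - x) (e := 1 - τ) (by linarith)
            (by linarith [hτ.2]) h
          have : 0 ≤ (majorant (1 - τ) - majorant (1 - x)) / (τ - x) :=
            div_nonneg_of_nonpos (by linarith) (by linarith [hτ.2])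
          linarith
        · have h4 := majorant_le_of_exp_le h (by linarith [hτ.1])
          rw [le_div_iff_of_neg (by linarith [hτ.2])]
          linarith)
    simp only [intervalIntegral.integral_const, smul_eq_mul, sub_zero] at hmono
    linarith
  have hcont : ContinuousOn (fun τ => majorant (1 - τ)) (uIcc x s) := by
    refine continuousOn_majorant.comp (by fun_prop) fun τ hτ => ?_
    rw [uIcc_of_le hxs.le] at hτ
    exact ⟨by linarith [hτ.2], by linarith [hτ.1]⟩
  have hR : (1 - x)⁻¹ * ((Real.log (profile (1 - x)) + 2)⁻¹ -
      (Real.log (profile (1 - s)) + 2)⁻¹) - majorant (1 - x) ≤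
      ∫ τ in x..s, -(cauchyPairing x τ).re := by
    have hmono := intervalIntegral.integral_mono_on_of_le_Ioo hxs.le
      (f := fun τ => (1 - x)⁻¹ * (majorant (1 - τ) - majorant (1 - x)))
      ((hcont.intervalIntegrable.sub intervalIntegrable_const).const_mul _) hq2 (fun τ hτ => by
        rw [hval τ (by linarith [hτ.1]) (by linarith [hτ.2]) hτ.1.ne', div_eq_inv_mul]
        have hge : majorant (1 - x) ≤ majorant (1 - τ) :=
          majorant_antitone (by linarith [hτ.2]) (by linarith [hτ.1]) (by linarith)
        refine mul_le_mul_of_nonneg_right ?_ (by linarith)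
        exact inv_anti₀ (by linarith [hτ.1]) (by linarith [hτ.2]))
    rw [intervalIntegral.integral_const_mul, intervalIntegral.integral_sub
      hcont.intervalIntegrable intervalIntegrable_const,
      integral_majorant_reflect hx0 hxs.le hs, intervalIntegral.integral_const,
      smul_eq_mul, mul_sub, ← mul_assoc] at hmono
    have h5 : (1 - x)⁻¹ * (s - x) ≤ 1 := by
      rw [inv_mul_le_iff₀ (by linarith)]; linarith
    have := mul_le_mul_of_nonneg_right h5 hmx
    linarith
  have hsplit := intervalIntegral.integral_add_adjacent_intervals hq1 hq2
  refine le_trans ?_ (Complex.re_le_norm _)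
  rw [hre, ← hsplit]
  linarith

lemma arg_one_add_ne_pi {z : ℂ} (hz : ‖z‖ ≤ 1) : (1 + z).arg ≠ π := by
  rcases eq_or_ne z (-1) with h | h
  · rw [h, add_neg_cancel, Complex.arg_zero]
    exact Real.pi_pos.ne
  · exact (Complex.mem_slitPlane_iff_arg.1 (Or.inl (one_add_re_pos hz h))).1

lemma norm_ofReal_mul_le_one {s : ℝ} (h0 : 0 ≤ s) (h1 : s ≤ 1) {z : ℂ} (hz : ‖z‖ = 1) :
    ‖(s : ℂ) * z‖ ≤ 1 := by
  rwa [norm_mul, hz, mul_one, Complex.norm_real, Real.norm_of_nonneg h0]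

lemma dilatedLog_inv_circlePt {s : ℝ} (h0 : 0 ≤ s) (h1 : s ≤ 1) (θ : ℝ) :
    dilatedLog s (circlePt θ)⁻¹ = (starRingEnd ℂ) (dilatedLog s (circlePt θ)) := by
  have h := Complex.log_conj (1 + s * circlePt θ)
    (arg_one_add_ne_pi (norm_ofReal_mul_le_one h0 h1 (norm_circlePt θ)))
  rw [map_add, map_mul, map_one, Complex.conj_ofReal] at h
  rw [dilatedLog, dilatedLog, inv_circlePt, h, map_sub, map_one]

lemma toeplitzSymbol_eq (θ : ℝ) : toeplitzSymbol θ =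
    dilatedLog 1 (circlePt θ) / (starRingEnd ℂ) (dilatedLog 1 (circlePt θ)) := by
  rw [← dilatedLog_inv_circlePt zero_le_one le_rfl, ← exp_neg_eq_inv]
  simp [toeplitzSymbol, dilatedLog, circlePt]

lemma norm_toeplitzSymbol_le (θ : ℝ) : ‖toeplitzSymbol θ‖ ≤ 1 := by
  rw [toeplitzSymbol_eq, norm_div, Complex.norm_conj]
  exact div_self_le_one _

@[fun_prop]
lemma measurable_toeplitzSymbol : Measurable toeplitzSymbol := by
  unfold toeplitzSymbol
  fun_prop

lemma differentiableOn_dilatedLog_mul_inv {s x r : ℝ} (hs0 : 0 ≤ s) (hx0 : 0 ≤ x) (hsr : s ≤ r)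
    (hxr : x ≤ r) : DifferentiableOn ℂ (fun w : ℂ => dilatedLog s w * (1 + x * w)⁻¹)
      (Metric.ball 0 r⁻¹) := by
  intro w hw
  rw [mem_ball_zero_iff] at hw
  have hr : 0 < r := inv_pos.1 ((norm_nonneg _).trans_lt hw)
  have key : ∀ y : ℝ, 0 ≤ y → y ≤ r → ‖(y : ℂ) * w‖ < 1 := by
    intro y h0 h1
    rw [norm_mul, Complex.norm_real, Real.norm_of_nonneg h0]
    calc y * ‖w‖ ≤ r * ‖w‖ := by gcongr
      _ < r * r⁻¹ := by gcongr
      _ = 1 := mul_inv_cancel₀ hr.ne'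
  have h1 := Complex.mem_slitPlane_of_norm_lt_one (key s hs0 hsr)
  have h2 := Complex.slitPlane_ne_zero (Complex.mem_slitPlane_of_norm_lt_one (key x hx0 hxr))
  apply DifferentiableAt.differentiableWithinAt
  unfold dilatedLog
  fun_prop (disch := assumption)

/-- The kernel testing a Toeplitz preimage, in dilated form. -/
noncomputable def testKernel (s x θ : ℝ) : ℂ :=
  toeplitzSymbol θ * (dilatedLog s (circlePt θ)⁻¹ * (1 + x * (circlePt θ)⁻¹)⁻¹) +
    circlePt θ * (dilatedLog s (circlePt θ) * (1 + x * circlePt θ)⁻¹)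

@[fun_prop]
lemma measurable_dilatedLog (s : ℝ) : Measurable (dilatedLog s) := by
  unfold dilatedLog
  fun_prop

lemma measurable_testKernel (s x : ℝ) : Measurable (testKernel s x) := by
  have := continuous_circlePt.measurable
  unfold testKernel
  fun_prop

lemma intervalIntegrable_toeplitzSymbol_mul {f : ℝ → ℂ}
    (hf : IntervalIntegrable f volume 0 (2 * π)) :
    IntervalIntegrable (fun θ => toeplitzSymbol θ * f θ) volume 0 (2 * π) := by
  refine hf.mono_fun ?_ ?_
  · exact measurable_toeplitzSymbol.aestronglyMeasurable.mul
      hf.def'.aestronglyMeasurable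
  · refine Eventually.of_forall fun θ => ?_
    simp only [norm_mul]
    exact mul_le_of_le_one_left (norm_nonneg _) (norm_toeplitzSymbol_le θ)

/-- A function in the Hardy space `H¹` whose Toeplitz image is the test function. -/
structure IsPreimage (f : ℝ → ℂ) : Prop where
  integrable : IntervalIntegrable f volume 0 (2 * π)
  analytic : ∀ n : ℕ, ∫ θ in (0 : ℝ)..(2 * π), f θ * circlePt θ * circlePt θ ^ n = 0
  image : ∀ n : ℕ, ∫ θ in (0 : ℝ)..(2 * π),
    (toeplitzSymbol θ * f θ - testExt (circlePt θ)) * (circlePt θ)⁻¹ ^ n = 0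

lemma continuousOn_dilatedLog_mul_inv {s x : ℝ} (hs0 : 0 < s) (hs1 : s < 1) (hx0 : 0 < x)
    (hx1 : x < 1) :
    ContinuousOn (fun w : ℂ => dilatedLog s w * (1 + x * w)⁻¹) (Metric.sphere 0 1) := by
  refine (differentiableOn_dilatedLog_mul_inv hs0.le hx0.le (le_max_left s x)
    (le_max_right s x)).continuousOn.mono fun w hw => ?_
  rw [mem_sphere_zero_iff_norm] at hw
  rw [mem_ball_zero_iff, hw]
  exact (one_lt_inv₀ (lt_max_of_lt_left hs0)).2 (max_lt hs1 hx1)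

lemma IsPreimage.integral_mul_testKernel {f : ℝ → ℂ} (hf : IsPreimage f) {s x : ℝ} (hs0 : 0 < s)
    (hs1 : s < 1) (hx0 : 0 < x) (hx1 : x < 1) :
    (1 / (2 * (π : ℂ))) * ∫ θ in (0 : ℝ)..(2 * π), f θ * testKernel s x θ = logPairing s x := by
  have hd := differentiableOn_dilatedLog_mul_inv hs0.le hx0.le (le_max_left s x)
    (le_max_right s x)
  have hR : 1 < (max s x)⁻¹ := (one_lt_inv₀ (lt_max_of_lt_left hs0)).2 (max_lt hs1 hx1)
  lift (max s x)⁻¹ to NNReal using zero_le_one.trans hR.le with R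
  have hR1 : 1 < R := by exact_mod_cast hR
  have hc := continuousOn_dilatedLog_mul_inv hs0 hs1 hx0 hx1
  have hc1 : Continuous fun θ => dilatedLog s (circlePt θ)⁻¹ * (1 + x * (circlePt θ)⁻¹)⁻¹ :=
    hc.comp_continuous continuous_inv_circlePt fun θ =>
      mem_sphere_zero_iff_norm.2 (norm_inv_circlePt θ)
  have hc2 : Continuous fun θ => dilatedLog s (circlePt θ) * (1 + x * circlePt θ)⁻¹ :=
    hc.comp_continuous continuous_circlePt fun θ => mem_sphere_zero_iff_norm.2 (norm_circlePt θ)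
  have hfz : IntervalIntegrable (fun θ => f θ * circlePt θ) volume 0 (2 * π) :=
    hf.integrable.mul_continuousOn continuous_circlePt.continuousOn
  have haf := intervalIntegrable_toeplitzSymbol_mul hf.integrable
  have e1 := integral_mul_comp_eq_zero
    (haf.sub intervalIntegrable_testExt) continuous_inv_circlePt
    norm_inv_circlePt hf.image hR1 hd
  have e2 := integral_mul_comp_eq_zero hfz continuous_circlePt norm_circlePt hf.analytic hR1 hd
  simp_rw [sub_mul] at e1
  rw [intervalIntegral.integral_sub (haf.mul_continuousOn hc1.continuousOn)
    (intervalIntegrable_testExt_mul hc1), sub_eq_zero] at e1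
  rw [logPairing, ← e1]
  congr 1
  rw [← add_zero (∫ θ in (0 : ℝ)..(2 * π), toeplitzSymbol θ * f θ *
    (dilatedLog s (circlePt θ)⁻¹ * (1 + x * (circlePt θ)⁻¹)⁻¹)), ← e2,
    ← intervalIntegral.integral_add
    (haf.mul_continuousOn hc1.continuousOn)
    (hfz.mul_continuousOn hc2.continuousOn)]
  congr 1
  ext θ
  rw [testKernel]
  ring

lemma norm_one_sub_log_le {w : ℂ} (h : 0 < w.re) : ‖1 - Complex.log w‖ ≤ |profile ‖w‖| + 2 := by
  refine (Complex.norm_le_abs_re_add_abs_im _).trans ?_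
  rw [one_sub_log_re]
  gcongr
  have h1 := Complex.abs_arg_le_pi_div_two_iff.2 h.le
  have := Real.pi_lt_four
  simp only [Complex.sub_im, Complex.one_im, Complex.log_im, zero_sub, abs_neg]
  linarith

lemma abs_im_dilatedLog_le {s : ℝ} {z : ℂ} (h : 0 < (1 + s * z).re) :
    |(dilatedLog s z).im| ≤ 2 := by
  have h1 := Complex.abs_arg_le_pi_div_two_iff.2 h.le
  have := Real.pi_lt_four
  simp only [dilatedLog, Complex.sub_im, Complex.one_im, Complex.log_im, zero_sub, abs_neg]
  linarith

lemma norm_dilatedLog_le {s : ℝ} (h0 : 1 / 2 ≤ s) (h1 : s ≤ 1) {z : ℂ} (hz : ‖z‖ = 1)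
    (hne : z ≠ -1) : ‖dilatedLog s z‖ ≤ 10 * profile ‖1 + z‖ := by
  have ht := norm_one_add_pos hne
  have hsz := norm_ofReal_mul_le_one (by linarith : 0 ≤ s) h1 hz
  have hlow : ‖1 + z‖ / 2 ≤ ‖1 + s * z‖ := by
    refine le_trans ?_ (norm_one_add_mul_ge hz.le (by linarith) h1)
    nlinarith
  have hne' : (s : ℂ) * z ≠ -1 := by
    intro h
    rw [h, add_neg_cancel, norm_zero] at hlow
    linarith
  have hlog := Real.log_le_log (by linarith) hlow
  rw [Real.log_div ht.ne' two_ne_zero] at hlog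
  have h2 := Real.log_two_lt_d9
  have h3 := profile_lower ht (norm_one_add_le hz.le)
  have h4 := profile_lower (norm_one_add_pos hne') (norm_one_add_le hsz)
  have h5 := norm_one_sub_log_le (one_add_re_pos hsz hne')
  rw [abs_of_nonneg (by linarith)] at h5
  rw [dilatedLog]
  unfold profile at *
  linarith

lemma profile_mul_le {d : ℝ} (h : 0 < d) : profile d * d ≤ 1 := by
  have h1 := Real.one_sub_inv_le_log_of_pos h
  have h2 : d * (1 - d⁻¹) ≤ d * Real.log d := by gcongr
  rw [mul_sub, mul_inv_cancel₀ h.ne'] at h2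
  unfold profile
  linarith

lemma inv_add_mul_inv_eq {x : ℝ} (h0 : 0 ≤ x) (h1 : x < 1) {z : ℂ} (hz : ‖z‖ = 1) :
    (1 + x * z⁻¹)⁻¹ + z * (1 + x * z)⁻¹ =
      (1 + x) * (1 + z) * ((1 + x * z⁻¹)⁻¹ * (1 + x * z)⁻¹) := by
  have hz0 : z ≠ 0 := norm_pos_iff.1 (by rw [hz]; exact one_pos)
  have h2 := one_add_mul_ne_zero h0 h1 hz
  have h3 := one_add_mul_ne_zero h0 h1 (w := z⁻¹) (by rw [norm_inv, hz, inv_one])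
  have key : ∀ A B : ℂ, A ≠ 0 → B ≠ 0 →
      A⁻¹ + z * B⁻¹ = (B + z * A) * (A⁻¹ * B⁻¹) := by
    intro A B hA hB
    field_simp
  rw [key _ _ h3 h2]
  congr 1
  field_simp
  ring

lemma norm_inv_add_mul_inv {x : ℝ} (h0 : 0 ≤ x) (h1 : x < 1) {z : ℂ} (hz : ‖z‖ = 1) :
    ‖(1 + x * z⁻¹)⁻¹ + z * (1 + x * z)⁻¹‖ = (1 + x) * ‖1 + z‖ * (‖1 + x * z‖ ^ 2)⁻¹ := by
  have h2 : 1 + x * z⁻¹ = (starRingEnd ℂ) (1 + x * z) := by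
    rw [Complex.inv_eq_conj hz]; simp
  have h3 : ‖(1 + x : ℂ)‖ = 1 + x := by
    rw [← Complex.ofReal_one, ← Complex.ofReal_add, Complex.norm_real,
      Real.norm_of_nonneg (by linarith)]
  rw [inv_add_mul_inv_eq h0 h1 hz, norm_mul, norm_mul, norm_mul, norm_inv, norm_inv, h2,
    Complex.norm_conj, h3, sq, mul_inv]

lemma testKernel_eq {s x : ℝ} (hs0 : 0 ≤ s) (hs1 : s ≤ 1) {θ : ℝ}
    (hne : (starRingEnd ℂ) (dilatedLog 1 (circlePt θ)) ≠ 0) :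
    testKernel s x θ =
      2 * Complex.I * ((dilatedLog 1 (circlePt θ)).im * dilatedLog s (circlePt θ) -
        dilatedLog 1 (circlePt θ) * (dilatedLog s (circlePt θ)).im) *
        ((starRingEnd ℂ) (dilatedLog 1 (circlePt θ)))⁻¹ * (1 + x * (circlePt θ)⁻¹)⁻¹ +
      dilatedLog s (circlePt θ) *
        ((1 + x * (circlePt θ)⁻¹)⁻¹ + circlePt θ * (1 + x * circlePt θ)⁻¹) := by
  rw [testKernel, toeplitzSymbol_eq, dilatedLog_inv_circlePt hs0 hs1]
  generalize dilatedLog 1 (circlePt θ) = u at hne ⊢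
  generalize dilatedLog s (circlePt θ) = v
  have hu := Complex.sub_conj u
  have hv := Complex.sub_conj v
  have e : 2 * Complex.I * (u.im * v - u * v.im) =
      u * (starRingEnd ℂ) v - (starRingEnd ℂ) u * v := by
    push_cast at hu hv
    linear_combination (-v) * hu + u * hv
  rw [e]
  generalize (1 + (x : ℂ) * (circlePt θ)⁻¹)⁻¹ = p
  generalize (1 + (x : ℂ) * circlePt θ)⁻¹ = q
  field_simp
  ring

lemma profile_le_norm_dilatedLog_one {θ : ℝ} :
    profile ‖1 + circlePt θ‖ ≤ ‖dilatedLog 1 (circlePt θ)‖ := by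
  rw [← one_sub_log_re]
  refine (Complex.re_le_norm _).trans_eq ?_
  simp [dilatedLog]

lemma conj_dilatedLog_one_ne_zero {θ : ℝ} (hne : circlePt θ ≠ -1) :
    (starRingEnd ℂ) (dilatedLog 1 (circlePt θ)) ≠ 0 := by
  rw [← norm_pos_iff, Complex.norm_conj]
  exact (profile_pos (norm_one_add_pos hne) (norm_one_add_le (norm_circlePt θ).le)).trans_le
    profile_le_norm_dilatedLog_one

lemma one_add_mul_re_pos {s : ℝ} (h0 : 0 ≤ s) (h1 : s ≤ 1) {z : ℂ} (hz : ‖z‖ = 1)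
    (hne : z ≠ -1) : 0 < (1 + s * z).re := by
  have h2 := one_add_re_pos hz.le hne
  simp only [Complex.add_re, Complex.one_re, Complex.re_ofReal_mul] at h2 ⊢
  rcases h1.eq_or_lt with rfl | h3
  · linarith
  · linarith [mul_nonneg h0 h2.le]

lemma norm_testKernel_le {s x : ℝ} (hs0 : 1 / 2 ≤ s) (hs1 : s ≤ 1) (hx0 : 0 ≤ x) (hx1 : x < 1)
    {θ : ℝ} (hne : circlePt θ ≠ -1) :
    ‖testKernel s x θ‖ ≤ 44 * (1 - x)⁻¹ + 20 * ((1 - x) ^ 2)⁻¹ := by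
  have hz := norm_circlePt θ
  have ht := norm_one_add_pos hne
  have hL := profile_pos ht (norm_one_add_le hz.le)
  have hu : profile ‖1 + circlePt θ‖ ≤ ‖dilatedLog 1 (circlePt θ)‖ :=
    profile_le_norm_dilatedLog_one
  have hU := norm_dilatedLog_le hs0 hs1 hz hne
  have hui := abs_im_dilatedLog_le (one_add_mul_re_pos zero_le_one le_rfl hz hne)
  have hUi := abs_im_dilatedLog_le (one_add_mul_re_pos (by linarith) hs1 hz hne)
  have hx := norm_inv_one_add_mul_le hx0 hx1 (norm_inv_circlePt θ)
  rw [testKernel_eq (by linarith) hs1 (conj_dilatedLog_one_ne_zero hne)]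
  refine (norm_add_le _ _).trans (add_le_add ?_ ?_)
  · have h1 : ‖((dilatedLog 1 (circlePt θ)).im * dilatedLog s (circlePt θ) -
        dilatedLog 1 (circlePt θ) * (dilatedLog s (circlePt θ)).im : ℂ)‖ ≤
        22 * ‖dilatedLog 1 (circlePt θ)‖ := by
      refine (norm_sub_le _ _).trans ?_
      rw [norm_mul, norm_mul, Complex.norm_real, Complex.norm_real, Real.norm_eq_abs,
        Real.norm_eq_abs]
      have e1 : |(dilatedLog 1 (circlePt θ)).im| * ‖dilatedLog s (circlePt θ)‖ ≤
          2 * (10 * ‖dilatedLog 1 (circlePt θ)‖) := by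
        gcongr; linarith
      have e2 := mul_le_mul_of_nonneg_left hUi (norm_nonneg (dilatedLog 1 (circlePt θ)))
      linarith
    rw [norm_mul, norm_mul, norm_mul, norm_inv, Complex.norm_conj]
    have h2 : ‖(2 * Complex.I : ℂ)‖ = 2 := by simp
    rw [h2]
    refine mul_le_mul ?_ hx (norm_nonneg _) (by norm_num)
    rw [← div_eq_mul_inv, div_le_iff₀ (hL.trans_le hu)]
    linarith
  · rw [norm_mul, norm_inv_add_mul_inv hx0 hx1 hz]
    have h1 : (‖1 + x * circlePt θ‖ ^ 2)⁻¹ ≤ ((1 - x) ^ 2)⁻¹ :=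
      inv_anti₀ (by have : 0 < 1 - x := by linarith
                    positivity)
        (pow_le_pow_left₀ (by linarith) (norm_one_add_mul_lower hx0 hz) 2)
    have h2 := profile_mul_le ht
    rw [← mul_assoc]
    refine mul_le_mul ?_ h1 (by positivity) (by norm_num)
    calc ‖dilatedLog s (circlePt θ)‖ * ((1 + x) * ‖1 + circlePt θ‖)
        ≤ (10 * profile ‖1 + circlePt θ‖) * (2 * ‖1 + circlePt θ‖) := by gcongr; linarith
      _ = 20 * (profile ‖1 + circlePt θ‖ * ‖1 + circlePt θ‖) := by ring
      _ ≤ 20 := by linarith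

lemma continuousAt_dilatedLog {z : ℂ} (hz : ‖z‖ = 1) (hne : z ≠ -1) :
    ContinuousAt (fun s => dilatedLog s z) 1 := by
  have h : 1 + ((1 : ℝ) : ℂ) * z ∈ Complex.slitPlane :=
    Or.inl (one_add_mul_re_pos zero_le_one le_rfl hz hne)
  unfold dilatedLog
  fun_prop (disch := assumption)

lemma IsPreimage.tendsto_logPairing {f : ℝ → ℂ} (hf : IsPreimage f) {x : ℝ} (hx0 : 0 < x)
    (hx1 : x < 1) :
    Tendsto (fun s => logPairing s x) (𝓝[<] 1) (𝓝 ((1 / (2 * (π : ℂ))) *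
      ∫ θ in (0 : ℝ)..(2 * π), f θ * testKernel 1 x θ)) := by
  have hs : ∀ᶠ s : ℝ in 𝓝[<] 1, s ∈ Ioo (1 / 2 : ℝ) 1 := Ioo_mem_nhdsLT (by norm_num)
  have hne : ∀ᵐ θ : ℝ, θ ∈ uIoc 0 (2 * π) → circlePt θ ≠ -1 := by
    filter_upwards [ae_ne_pi] with θ hθ hm h
    rw [uIoc_of_le (by positivity)] at hm
    exact hθ (circlePt_eq_neg_one hm.1.le hm.2 h)
  have key : Tendsto (fun s => ∫ θ in (0 : ℝ)..(2 * π), f θ * testKernel s x θ) (𝓝[<] 1)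
      (𝓝 (∫ θ in (0 : ℝ)..(2 * π), f θ * testKernel 1 x θ)) := by
    refine intervalIntegral.tendsto_integral_filter_of_dominated_convergence
      (fun θ => ‖f θ‖ * (44 * (1 - x)⁻¹ + 20 * ((1 - x) ^ 2)⁻¹)) ?_ ?_
      (hf.integrable.norm.mul_const _) ?_
    · exact Eventually.of_forall fun s => hf.integrable.def'.aestronglyMeasurable.mul
        (measurable_testKernel s x).aestronglyMeasurable
    · filter_upwards [hs] with s hs
      filter_upwards [hne] with θ hθ hm
      rw [norm_mul]
      gcongr
      exact norm_testKernel_le hs.1.le hs.2.le hx0.le hx1 (hθ hm)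
    · filter_upwards [hne] with θ hθ hm
      refine Tendsto.mul tendsto_const_nhds ?_
      have h1 := continuousAt_dilatedLog (norm_circlePt θ) (hθ hm)
      have h2 := continuousAt_dilatedLog (norm_inv_circlePt θ)
        (fun h => hθ hm (by rw [inv_eq_iff_eq_inv] at h; rw [h]; norm_num))
      have h3 : ContinuousAt (fun s => testKernel s x θ) 1 := by
        unfold testKernel
        fun_prop
      exact h3.tendsto.mono_left nhdsWithin_le_nhds
  refine (key.const_mul (1 / (2 * (π : ℂ)))).congr' ?_
  filter_upwards [hs] with s hs
  exact hf.integral_mul_testKernel (by linarith [hs.1]) hs.2 hx0 hx1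

lemma tendsto_log_profile :
    Tendsto (fun x => Real.log (profile (1 - x)) + 2) (𝓝[<] 1) atTop := by
  have h1 : Tendsto (fun x : ℝ => 1 - x) (𝓝[<] 1) (𝓝[>] 0) := by
    refine tendsto_nhdsWithin_of_tendsto_nhds_of_eventually_within _ ?_ ?_
    · have : Continuous fun x : ℝ => 1 - x := by fun_prop
      simpa using (this.tendsto 1).mono_left nhdsWithin_le_nhds
    · filter_upwards [self_mem_nhdsWithin] with x hx
      exact sub_pos.2 (mem_Iio.1 hx)
  have h2 : Tendsto profile (𝓝[>] 0) atTop :=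
    tendsto_atTop_add_const_left _ 1 (tendsto_neg_atBot_atTop.comp Real.tendsto_log_nhdsGT_zero)
  exact tendsto_atTop_add_const_right _ 2 (Real.tendsto_log_atTop.comp (h2.comp h1))

lemma IsPreimage.norm_integral_lower {f : ℝ → ℂ} (hf : IsPreimage f) {x : ℝ} (hx : 9 / 10 ≤ x)
    (hx1 : x < 1) :
    (1 - x)⁻¹ * (Real.log (profile (1 - x)) + 2)⁻¹ - 160 ≤
      ‖(1 / (2 * (π : ℂ))) * ∫ θ in (0 : ℝ)..(2 * π), f θ * testKernel 1 x θ‖ := by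
  have h1 := (hf.tendsto_logPairing (by linarith) hx1).norm
  have h2 := (((tendsto_inv_atTop_zero.comp tendsto_log_profile).const_sub
    (Real.log (profile (1 - x)) + 2)⁻¹).const_mul (1 - x)⁻¹).sub_const 160
  rw [sub_zero] at h2
  refine le_of_tendsto_of_tendsto h2 h1 ?_
  filter_upwards [Ioo_mem_nhdsLT hx1] with s hs
  exact logPairing_lower hx hs.1 hs.2

lemma one_le_profile {d : ℝ} (h0 : 0 < d) (h1 : d ≤ 1) : 1 ≤ profile d := by
  have := Real.log_nonpos h0.le h1
  unfold profile
  linarith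

/-- The majorant of the limiting test kernel at distance `t` from `-1`, relative to the profile. -/
noncomputable def kernelBound (x t : ℝ) : ℝ := 90 * (√t * ((1 - x + t) * √(1 - x + t))⁻¹)

lemma abs_profile_add_two_le {d t : ℝ} (hd : 0 < d) (hd1 : d ≤ 1) (ht : 0 < t) (ht2 : t ≤ 2) :
    |profile t| + 2 ≤ 5 * (√(d + t) / √t) * profile d := by
  have hP := one_le_profile hd hd1
  have hst : 0 < √t := Real.sqrt_pos.2 ht
  have hq1 : 1 ≤ √(d + t) / √t := by
    rw [one_le_div hst]
    exact Real.sqrt_le_sqrt (by linarith)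
  have hlog : Real.log (√(d + t) / √t) ≤ √(d + t) / √t :=
    (Real.log_le_sub_one_of_pos (by linarith)).trans (by linarith)
  have hs : 0 < √(d + t) := Real.sqrt_pos.2 (by linarith)
  rw [Real.log_div hs.ne' hst.ne', Real.log_sqrt (by linarith), Real.log_sqrt ht.le] at hlog
  have hmono := Real.log_le_log hd (by linarith : d ≤ d + t)
  rw [abs_of_pos (profile_pos ht ht2)]
  generalize √(d + t) / √t = q at *
  have h3 : profile t ≤ profile d + 2 * q := by
    unfold profile
    linarith
  nlinarith [mul_le_mul_of_nonneg_left hP (by linarith : 0 ≤ q)]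

lemma norm_testKernel_one_le {x : ℝ} (hx : 1 / 2 ≤ x) (hx1 : x < 1) {θ : ℝ}
    (hne : circlePt θ ≠ -1) :
    ‖testKernel 1 x θ‖ ≤ profile (1 - x) * kernelBound x ‖1 + circlePt θ‖ := by
  have hz := norm_circlePt θ
  have ht := norm_one_add_pos hne
  have ht2 := norm_one_add_le hz.le
  have hu : ‖dilatedLog 1 (circlePt θ)‖ ≤ |profile ‖1 + circlePt θ‖| + 2 := by
    have h := one_add_mul_re_pos zero_le_one le_rfl hz hne
    have := norm_one_sub_log_le h
    simpa [dilatedLog] using this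
  have hb := hu.trans (abs_profile_add_two_le (d := 1 - x) (by linarith) (by linarith) ht ht2)
  have e1 := norm_one_add_mul_lower (x := x) (by linarith) hz
  have e2 := norm_one_add_mul_ge hz.le (ρ := x) (by linarith) hx1.le
  rw [testKernel_eq zero_le_one le_rfl (conj_dilatedLog_one_ne_zero hne),
    mul_comm ((dilatedLog 1 (circlePt θ)).im : ℂ), sub_self, mul_zero, zero_mul, zero_mul, zero_add,
    norm_mul, norm_inv_add_mul_inv (by linarith) hx1 hz]
  generalize ‖1 + circlePt θ‖ = t at *
  generalize ‖1 + (x : ℂ) * circlePt θ‖ = B at *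
  generalize ‖dilatedLog 1 (circlePt θ)‖ = u at *
  have hB : (1 - x + t) / 3 ≤ B := by nlinarith
  have hs : 0 < 1 - x + t := by linarith
  have hB2 : (B ^ 2)⁻¹ ≤ 9 * ((1 - x + t) ^ 2)⁻¹ := by
    have : (((1 - x + t) / 3) ^ 2)⁻¹ = 9 * ((1 - x + t) ^ 2)⁻¹ := by
      rw [div_pow, inv_div, div_eq_mul_inv]; norm_num
    rw [← this]
    exact inv_anti₀ (by positivity) (pow_le_pow_left₀ (by positivity) hB 2)
  have hP : 0 < profile (1 - x) := profile_pos (by linarith) (by linarith)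
  calc u * ((1 + x) * t * (B ^ 2)⁻¹)
      ≤ (5 * (√(1 - x + t) / √t) * profile (1 - x)) *
        (2 * t * (9 * ((1 - x + t) ^ 2)⁻¹)) := by
        gcongr
        linarith
    _ = profile (1 - x) * kernelBound x t := by
      have ha : 0 < √(1 - x + t) := Real.sqrt_pos.2 hs
      have hb : 0 < √t := Real.sqrt_pos.2 ht
      have ha2 := Real.sq_sqrt hs.le
      have hb2 := Real.sq_sqrt ht.le
      unfold kernelBound
      generalize √(1 - x + t) = a at *
      generalize √t = b at *
      rw [← ha2, ← hb2]
      field_simp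
      norm_num

lemma lintegral_kernelBound_le {t : ℝ} (ht : 0 ≤ t) :
    ∫⁻ x in Ioo (9 / 10 : ℝ) 1, ENNReal.ofReal (kernelBound x t) ≤ 180 := by
  rcases ht.eq_or_lt with rfl | ht
  · simp [kernelBound]
  have hst : 0 < √t := Real.sqrt_pos.2 ht
  have hd : ∀ x ∈ uIcc (9 / 10 : ℝ) 1,
      HasDerivAt (fun x => 180 * √t * (√(1 - x + t))⁻¹) (kernelBound x t) x := by
    intro x hx
    rw [uIcc_of_le (by norm_num)] at hx
    have hs : 0 < 1 - x + t := by linarith [hx.2]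
    have h1 : HasDerivAt (fun x : ℝ => 1 - x + t) (-1) x :=
      ((hasDerivAt_id x).const_sub 1).add_const t
    have hq : 0 < √(1 - x + t) := Real.sqrt_pos.2 hs
    refine (((h1.sqrt hs.ne').fun_inv hq.ne').const_mul (180 * √t)).congr_deriv ?_
    rw [Real.sq_sqrt hs.le]
    unfold kernelBound
    field_simp
    norm_num
  have hc : ContinuousOn (fun x => kernelBound x t) (uIcc (9 / 10 : ℝ) 1) := by
    intro x hx
    rw [uIcc_of_le (by norm_num)] at hx
    have hs : 0 < 1 - x + t := by linarith [hx.2]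
    have hq : (1 - x + t) * √(1 - x + t) ≠ 0 := (mul_pos hs (Real.sqrt_pos.2 hs)).ne'
    apply ContinuousAt.continuousWithinAt
    unfold kernelBound
    fun_prop (disch := assumption)
  have hint := hc.intervalIntegrable (μ := volume)
  have hval := intervalIntegral.integral_eq_sub_of_hasDerivAt hd hint
  rw [intervalIntegral.integral_of_le (by norm_num), integral_Ioc_eq_integral_Ioo] at hval
  rw [intervalIntegrable_iff_integrableOn_Ioo_of_le (by norm_num)] at hint
  rw [← ofReal_integral_eq_lintegral_ofReal hint, hval]
  · rw [ENNReal.ofReal_le_iff_le_toReal (by simp)]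
    have h1 : 180 * √t * (√(1 - 1 + t))⁻¹ = 180 := by
      rw [sub_self, zero_add, mul_assoc, mul_inv_cancel₀ hst.ne', mul_one]
    have h2 : 0 ≤ 180 * √t * (√(1 - 9 / 10 + t))⁻¹ := by positivity
    rw [h1]
    simpa using h2
  · refine (ae_restrict_iff' measurableSet_Ioo).2 (Eventually.of_forall fun x hx => ?_)
    have : 0 < 1 - x := by linarith [hx.2]
    simp only [Pi.zero_apply, kernelBound]
    positivity

/-- The derivative of the iterated logarithm of the profile, which is not integrable at `1`. -/
noncomputable def iteratedLogDeriv (x : ℝ) : ℝ :=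
  (profile (1 - x))⁻¹ * ((1 - x)⁻¹ * (Real.log (profile (1 - x)) + 2)⁻¹)

lemma not_integrableOn_iteratedLogDeriv : ¬ IntegrableOn iteratedLogDeriv (Ioo (9 / 10) 1) := by
  have hd : ∀ᶠ x in 𝓝[<] (1 : ℝ), HasDerivAt
      (fun x => Real.log (Real.log (profile (1 - x)) + 2)) (iteratedLogDeriv x) x := by
    filter_upwards [Ioo_mem_nhdsLT (zero_lt_one (α := ℝ))] with x hx
    have h0 : 0 < 1 - x := by linarith [hx.2]
    have h2 : 1 - x ≤ 2 := by linarith [hx.1]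
    have h1 : HasDerivAt (fun x : ℝ => 1 - x) (-1) x := (hasDerivAt_id x).const_sub 1
    refine (((hasDerivAt_log_profile h0 h2).comp x h1).log
      (log_profile_pos h0 h2).ne').congr_deriv ?_
    have := profile_pos h0 h2
    have := log_profile_pos h0 h2
    rw [Function.comp_apply, iteratedLogDeriv]
    field_simp
  refine not_integrableOn_of_tendsto_norm_atTop_of_deriv_isBigO_filter (𝓝[<] (1 : ℝ))
    (f := fun x => Real.log (Real.log (profile (1 - x)) + 2))
    (Ioo_mem_nhdsLT (by norm_num)) (hd.mono fun x hx => hx.differentiableAt) ?_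
    (EventuallyEq.isBigO (hd.mono fun x hx => hx.deriv))
  exact tendsto_norm_atTop_atTop.comp (Real.tendsto_log_atTop.comp tendsto_log_profile)

lemma IsPreimage.enorm_iteratedLogDeriv_le {f : ℝ → ℂ} (hf : IsPreimage f) {x : ℝ}
    (hx : x ∈ Ioo (9 / 10 : ℝ) 1) :
    ‖iteratedLogDeriv x‖ₑ ≤ 160 + ∫⁻ θ in Ioc 0 (2 * π),
      ‖f θ‖ₑ * ENNReal.ofReal (kernelBound x ‖1 + circlePt θ‖) := by
  have h0 : 0 < 1 - x := by linarith [hx.2]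
  have h1 : 1 - x ≤ 1 := by linarith [hx.1]
  have hP := one_le_profile h0 h1
  have hJ := log_profile_pos h0 (by linarith)
  have hlow := hf.norm_integral_lower hx.1.le hx.2
  rw [norm_mul] at hlow
  have hpi : ‖(1 / (2 * (π : ℂ)))‖ ≤ 1 := by
    rw [norm_div, norm_one, norm_mul, Complex.norm_real, Real.norm_of_nonneg Real.pi_pos.le,
      Complex.norm_ofNat, div_le_one (by positivity)]
    linarith [Real.pi_gt_three]
  have hle := mul_le_of_le_one_left
    (norm_nonneg (∫ θ in (0 : ℝ)..(2 * π), f θ * testKernel 1 x θ)) hpi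
  have hreal : profile (1 - x) * iteratedLogDeriv x ≤
      160 + ‖∫ θ in (0 : ℝ)..(2 * π), f θ * testKernel 1 x θ‖ := by
    rw [iteratedLogDeriv, ← mul_assoc, mul_inv_cancel₀ (by linarith), one_mul]
    linarith
  have hnn : 0 ≤ iteratedLogDeriv x := by
    unfold iteratedLogDeriv
    positivity
  have hint : ‖∫ θ in (0 : ℝ)..(2 * π), f θ * testKernel 1 x θ‖ₑ ≤
      ENNReal.ofReal (profile (1 - x)) * ∫⁻ θ in Ioc 0 (2 * π),
        ‖f θ‖ₑ * ENNReal.ofReal (kernelBound x ‖1 + circlePt θ‖) := by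
    rw [intervalIntegral.integral_of_le (by positivity)]
    refine (enorm_integral_le_lintegral_enorm _).trans ?_
    rw [← lintegral_const_mul' _ _ ENNReal.ofReal_ne_top]
    refine lintegral_mono_ae ((ae_restrict_iff' measurableSet_Ioc).2 ?_)
    filter_upwards [ae_ne_pi] with θ hθ hm
    have hk := norm_testKernel_one_le (by linarith [hx.1]) hx.2
      (fun h => hθ (circlePt_eq_neg_one hm.1.le hm.2 h))
    rw [enorm_mul, mul_left_comm, ← ENNReal.ofReal_mul (by linarith), ← ofReal_norm]
    gcongr
    rw [← ofReal_norm]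
    exact ENNReal.ofReal_le_ofReal hk
  have hP0 : ENNReal.ofReal (profile (1 - x)) ≠ 0 := by
    rw [Ne, ENNReal.ofReal_eq_zero]; linarith
  rw [← ENNReal.mul_le_mul_iff_right hP0 ENNReal.ofReal_ne_top,
    Real.enorm_eq_ofReal hnn, ← ENNReal.ofReal_mul (by linarith), mul_add]
  refine (ENNReal.ofReal_le_ofReal hreal).trans ?_
  rw [ENNReal.ofReal_add (by norm_num) (norm_nonneg _), ofReal_norm]
  refine add_le_add ?_ hint
  rw [ENNReal.ofReal_ofNat]
  exact le_mul_of_one_le_left' (by rwa [ENNReal.one_le_ofReal])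

lemma IsPreimage.false {f : ℝ → ℂ} (hf : IsPreimage f) : False := by
  refine not_integrableOn_iteratedLogDeriv ⟨?_, ?_⟩
  · refine Measurable.aestronglyMeasurable ?_
    unfold iteratedLogDeriv profile
    fun_prop
  have hfi := hf.integrable.1
  have hm : AEMeasurable (Function.uncurry fun x θ : ℝ =>
      ‖f θ‖ₑ * ENNReal.ofReal (kernelBound x ‖1 + circlePt θ‖))
      ((volume.restrict (Ioo (9 / 10 : ℝ) 1)).prod (volume.restrict (Ioc 0 (2 * π)))) := by
    refine (hfi.aestronglyMeasurable.aemeasurable.comp_snd.enorm).mul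
      (Measurable.aemeasurable ?_)
    have := continuous_circlePt.measurable
    unfold kernelBound
    fun_prop
  rw [hasFiniteIntegral_iff_enorm]
  calc ∫⁻ x in Ioo (9 / 10 : ℝ) 1, ‖iteratedLogDeriv x‖ₑ
      ≤ ∫⁻ x in Ioo (9 / 10 : ℝ) 1, (160 + ∫⁻ θ in Ioc 0 (2 * π),
        ‖f θ‖ₑ * ENNReal.ofReal (kernelBound x ‖1 + circlePt θ‖)) :=
        setLIntegral_mono' measurableSet_Ioo fun x hx => hf.enorm_iteratedLogDeriv_le hx
    _ = 160 * volume (Ioo (9 / 10 : ℝ) 1) + ∫⁻ θ in Ioc 0 (2 * π),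
        ‖f θ‖ₑ * ∫⁻ x in Ioo (9 / 10 : ℝ) 1,
          ENNReal.ofReal (kernelBound x ‖1 + circlePt θ‖) := by
        rw [lintegral_add_left measurable_const, setLIntegral_const, lintegral_lintegral_swap hm]
        simp_rw [lintegral_const_mul' _ _ enorm_ne_top]
    _ ≤ 160 * volume (Ioo (9 / 10 : ℝ) 1) + ∫⁻ θ in Ioc 0 (2 * π), ‖f θ‖ₑ * 180 := by
        gcongr
        exact lintegral_kernelBound_le (norm_nonneg _)
    _ < ⊤ := by
        rw [lintegral_mul_const' _ _ (by simp)]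
        refine ENNReal.add_lt_top.2 ⟨?_, ENNReal.mul_lt_top hfi.2 (by simp)⟩
        rw [Real.volume_Ioo]
        exact ENNReal.mul_lt_top (by simp) ENNReal.ofReal_lt_top

end ToeplitzLog

open ToeplitzLog

/-- The function `g` above belongs to `H¹` of the circle but has no `H¹`
preimage under the Toeplitz operator `T_a`; hence the range of `T_a` is a proper subspace
of `H¹` and `T_a` is not Fredholm. -/
theorem toeplitz_test_fun_not_in_range :
    IntervalIntegrable toeplitzTestFun volume 0 (2 * π) ∧
    (∀ n : ℤ, n < 0 →
      (1 / (2 * (π : ℂ))) * ∫ θ in (0:ℝ)..(2 * π),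
          toeplitzTestFun θ * Complex.exp (-(n : ℂ) * (θ : ℂ) * Complex.I) = 0) ∧
    ¬ ∃ f : ℝ → ℂ,
        (∀ θ : ℝ, f (θ + 2 * π) = f θ) ∧
        IntervalIntegrable f volume 0 (2 * π) ∧
        (∀ n : ℤ, n < 0 →
          (1 / (2 * (π : ℂ))) * ∫ θ in (0:ℝ)..(2 * π),
              f θ * Complex.exp (-(n : ℂ) * (θ : ℂ) * Complex.I) = 0) ∧
        (∀ n : ℤ, 0 ≤ n →
          (1 / (2 * (π : ℂ))) * ∫ θ in (0:ℝ)..(2 * π),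
              toeplitzSymbol θ * f θ * Complex.exp (-(n : ℂ) * (θ : ℂ) * Complex.I) =
            (1 / (2 * (π : ℂ))) * ∫ θ in (0:ℝ)..(2 * π),
              toeplitzTestFun θ * Complex.exp (-(n : ℂ) * (θ : ℂ) * Complex.I)) := by
  refine ⟨intervalIntegrable_testExt, ?_, ?_⟩
  · intro n hn
    obtain ⟨k, rfl⟩ : ∃ k : ℕ, n = -k := ⟨n.natAbs, by omega⟩
    simp_rw [exp_fourier, neg_neg, zpow_natCast]
    exact testExt_fourier_neg k (by omega)
  · rintro ⟨f, -, hfi, hneg, hpos⟩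
    have hpi : (1 / (2 * (π : ℂ))) ≠ 0 := by simp
    refine IsPreimage.false (f := f) ⟨hfi, fun n => ?_, fun n => ?_⟩
    · have h := (mul_eq_zero.1 (hneg (-(n + 1 : ℕ)) (by omega))).resolve_left hpi
      simp_rw [exp_fourier, neg_neg, zpow_natCast] at h
      simpa only [pow_succ', mul_assoc] using h
    · have h := mul_left_cancel₀ hpi (hpos n (Int.natCast_nonneg n))
      simp_rw [exp_fourier, zpow_neg, zpow_natCast, ← inv_pow] at h
      have hc : Continuous fun θ => (circlePt θ)⁻¹ ^ n := by fun_prop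
      simp_rw [sub_mul]
      rw [intervalIntegral.integral_sub
        ((intervalIntegrable_toeplitzSymbol_mul hfi).mul_continuousOn hc.continuousOn)
        (intervalIntegrable_testExt_mul hc), sub_eq_zero]
      exact h
end

section
/- Let g(t) = 1 / ((1 + t) · (1 - log(1 + t)) · (log(1 - log(1 + t)) + 2)²) for real t ∈ (-1, 0]. There exist C > 0 and δ ∈ (0,1) such that for all θ ∈ (0, δ): | ∫_{-1}^0 g(t) · ((1 + t)/(t + e^{iθ}) - 1) dt + 1/(log(1 - log θ) + 2) | ≤ C / (|log θ| · (log(-log θ))²), where |·| denotes the complex modulus. -/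
open MeasureTheory intervalIntegral

/-- The logarithmic weight `k(s) = 1/((1 - log s)(log(1 - log s) + 2)²)`. -/
noncomputable def logWeight (s : ℝ) : ℝ :=
  1 / ((1 - Real.log s) * (Real.log (1 - Real.log s) + 2) ^ 2)

/-- The primitive `1/(log(1 - log s) + 2)` of `logWeight s / s`, extended by `0` at `s = 0`. -/
noncomputable def logPrimitive : ℝ → ℝ :=
  Function.update (fun s => 1 / (Real.log (1 - Real.log s) + 2)) 0 0

lemma one_le_one_sub_log {s : ℝ} (h0 : 0 < s) (h1 : s ≤ 1) : 1 ≤ 1 - Real.log s := by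
  have := Real.log_nonpos h0.le h1
  linarith

lemma two_le_log_one_sub_log {s : ℝ} (h0 : 0 < s) (h1 : s ≤ 1) :
    2 ≤ Real.log (1 - Real.log s) + 2 := by
  have := Real.log_nonneg (one_le_one_sub_log h0 h1)
  linarith

lemma logWeight_pos {s : ℝ} (h0 : 0 < s) (h1 : s ≤ 1) : 0 < logWeight s := by
  have := one_le_one_sub_log h0 h1
  have := two_le_log_one_sub_log h0 h1
  unfold logWeight
  positivity

lemma logWeight_mono {s r : ℝ} (h0 : 0 < s) (hsr : s ≤ r) (h1 : r ≤ 1) :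
    logWeight s ≤ logWeight r := by
  have a := one_le_one_sub_log (h0.trans_le hsr) h1
  have b := two_le_log_one_sub_log (h0.trans_le hsr) h1
  have c := Real.log_le_log h0 hsr
  have d := one_le_one_sub_log h0 (hsr.trans h1)
  unfold logWeight
  gcongr

lemma one_add_pow_three_le_exp {u : ℝ} (hu : 0 ≤ u) :
    (1 + u) ^ 3 ≤ 216 * Real.exp (u / 2) := by
  have h : 1 + u ≤ 6 * Real.exp (u / 6) := by
    have := Real.add_one_le_exp (u / 6)
    linarith
  calc (1 + u) ^ 3 ≤ (6 * Real.exp (u / 6)) ^ 3 := by gcongr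
    _ = 216 * Real.exp (u / 2) := by
      rw [mul_pow, ← Real.exp_nat_mul]
      norm_num
      ring

lemma logWeight_le_mul_rpow {r s : ℝ} (h0 : 0 < r) (hrs : r ≤ s) (h1 : s ≤ 1) :
    logWeight s ≤ 216 * logWeight r * (s / r) ^ (1 / 2 : ℝ) := by
  have hs : 0 < s := h0.trans_le hrs
  have a := one_le_one_sub_log hs h1
  have b := two_le_log_one_sub_log hs h1
  have a' := one_le_one_sub_log h0 (hrs.trans h1)
  have b' := two_le_log_one_sub_log h0 (hrs.trans h1)
  have hu : 0 ≤ Real.log (s / r) := Real.log_nonneg ((one_le_div h0).2 hrs)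
  have hexp : (s / r) ^ (1 / 2 : ℝ) = Real.exp (Real.log (s / r) / 2) := by
    rw [Real.rpow_def_of_pos (by positivity)]
    ring_nf
  have hlog : Real.log (s / r) = Real.log s - Real.log r := Real.log_div hs.ne' h0.ne'
  have hcube := one_add_pow_three_le_exp hu
  rw [hexp]
  set u := Real.log (s / r)
  have hA : 1 - Real.log r ≤ (1 - Real.log s) * (1 + u) := by nlinarith
  have hB : Real.log (1 - Real.log r) + 2 ≤ (Real.log (1 - Real.log s) + 2) * (1 + u) := by
    have h := Real.log_le_log (by linarith) hA
    rw [Real.log_mul (by linarith) (by linarith)] at h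
    have := Real.log_le_sub_one_of_pos (show 0 < 1 + u by linarith)
    nlinarith
  unfold logWeight
  set A := 1 - Real.log s
  set B := Real.log A + 2
  set A' := 1 - Real.log r
  set B' := Real.log A' + 2
  have key : A' * B' ^ 2 ≤ A * B ^ 2 * (216 * Real.exp (u / 2)) :=
    calc A' * B' ^ 2 ≤ (A * (1 + u)) * (B * (1 + u)) ^ 2 := by gcongr
      _ = A * B ^ 2 * (1 + u) ^ 3 := by ring
      _ ≤ _ := by gcongr
  have hp : 0 < A' * B' ^ 2 := by positivity
  have hq : 0 < A * B ^ 2 := by positivity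
  rw [show 216 * (1 / (A' * B' ^ 2)) * Real.exp (u / 2) =
    216 * Real.exp (u / 2) / (A' * B' ^ 2) by ring, div_le_div_iff₀ hq hp]
  linarith

lemma hasDerivAt_logPrimitive {s : ℝ} (h0 : 0 < s) (h1 : s ≤ 1) :
    HasDerivAt logPrimitive (logWeight s / s) s := by
  have a := one_le_one_sub_log h0 h1
  have b := two_le_log_one_sub_log h0 h1
  have h : HasDerivAt (fun s => 1 / (Real.log (1 - Real.log s) + 2)) (logWeight s / s) s := by
    have hd := ((((Real.hasDerivAt_log h0.ne').const_sub 1).log (by linarith)).add_const 2).inv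
      (by linarith)
    simp only [one_div]
    refine hd.congr_deriv ?_
    unfold logWeight
    have hA : 1 - Real.log s ≠ 0 := by linarith
    have hB : Real.log (1 - Real.log s) + 2 ≠ 0 := by linarith
    field_simp
  refine h.congr_of_eventuallyEq ?_
  filter_upwards [eventually_ne_nhds h0.ne'] with x hx
  simp [logPrimitive, hx]

lemma continuousOn_logPrimitive : ContinuousOn logPrimitive (Set.Icc 0 1) := by
  intro s hs
  rcases hs.1.eq_or_lt with rfl | h0
  · unfold logPrimitive
    rw [continuousWithinAt_update_same]
    have h : Filter.Tendsto (fun s => 1 / (Real.log (1 - Real.log s) + 2))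
        (nhdsWithin 0 (Set.Ioi 0)) (nhds 0) := by
      simp only [one_div]
      refine Filter.Tendsto.inv_tendsto_atTop ?_
      refine Filter.tendsto_atTop_add_const_right _ _ (Real.tendsto_log_atTop.comp ?_)
      simp only [sub_eq_add_neg]
      exact Filter.tendsto_atTop_add_const_left _ _
        (Filter.tendsto_neg_atBot_atTop.comp Real.tendsto_log_nhdsGT_zero)
    exact h.mono_left (nhdsWithin_mono _ fun x hx => lt_of_le_of_ne hx.1.1 (Ne.symm hx.2))
  · exact (hasDerivAt_logPrimitive h0 hs.2).continuousAt.continuousWithinAt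

lemma intervalIntegrable_logWeight_div {r : ℝ} (h0 : 0 ≤ r) (h1 : r ≤ 1) :
    IntervalIntegrable (fun s => logWeight s / s) volume 0 r := by
  refine intervalIntegrable_deriv_of_nonneg (g := logPrimitive) ?_ ?_ ?_
  · rw [Set.uIcc_of_le h0]
    exact continuousOn_logPrimitive.mono (Set.Icc_subset_Icc_right h1)
  · intro x hx
    rw [min_eq_left h0, max_eq_right h0] at hx
    exact hasDerivAt_logPrimitive hx.1 (hx.2.le.trans h1)
  · intro x hx
    rw [min_eq_left h0, max_eq_right h0] at hx
    exact div_nonneg (logWeight_pos hx.1 (hx.2.le.trans h1)).le hx.1.le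

lemma intervalIntegrable_ofReal_logWeight_div {r : ℝ} (h0 : 0 ≤ r) (h1 : r ≤ 1) :
    IntervalIntegrable (fun s => ((logWeight s / s : ℝ) : ℂ)) volume 0 r :=
  have h := intervalIntegrable_logWeight_div h0 h1
  ⟨Integrable.ofReal h.1, Integrable.ofReal h.2⟩

lemma integral_logWeight_div {r : ℝ} (h0 : 0 < r) (h1 : r ≤ 1) :
    ∫ s in (0:ℝ)..r, logWeight s / s = 1 / (Real.log (1 - Real.log r) + 2) := by
  rw [integral_eq_sub_of_hasDerivAt_of_le h0.le
    (continuousOn_logPrimitive.mono (Set.Icc_subset_Icc_right h1))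
    (fun x hx => hasDerivAt_logPrimitive hx.1 (hx.2.le.trans h1))
    (intervalIntegrable_logWeight_div h0.le h1)]
  simp [logPrimitive, h0.ne']

lemma half_le_norm_add_exp_sub_one (s : ℝ) {θ : ℝ} (h0 : 0 < θ) (h1 : θ ≤ 1) :
    θ / 2 ≤ ‖(s : ℂ) + (Complex.exp (θ * Complex.I) - 1)‖ := by
  have h := Complex.abs_im_le_norm ((s : ℂ) + (Complex.exp (θ * Complex.I) - 1))
  have him : ((s : ℂ) + (Complex.exp (θ * Complex.I) - 1)).im = Real.sin θ := by
    simp [Complex.exp_ofReal_mul_I_im]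
  rw [him] at h
  have h2 : θ - θ ^ 3 / 4 < Real.sin θ := by
    have := Real.sin_gt_sub_cube h0
    have : 0 < θ ^ 3 := by positivity
    linarith
  have h3 : θ ^ 3 ≤ θ := by nlinarith [mul_nonneg h0.le (sub_nonneg.2 h1)]
  linarith [le_abs_self (Real.sin θ)]

lemma half_le_norm_add_exp_sub_one_of_le {s θ : ℝ} (h0 : 0 < θ) (h1 : θ ≤ 1) (hs : θ ≤ s) :
    s / 2 ≤ ‖(s : ℂ) + (Complex.exp (θ * Complex.I) - 1)‖ := by
  have h := Complex.re_le_norm ((s : ℂ) + (Complex.exp (θ * Complex.I) - 1))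
  have hre : ((s : ℂ) + (Complex.exp (θ * Complex.I) - 1)).re = s + (Real.cos θ - 1) := by
    simp [Complex.exp_ofReal_mul_I_re]
  rw [hre] at h
  have h2 := Real.one_sub_sq_div_two_le_cos (x := θ)
  nlinarith

lemma norm_exp_sub_one_le {θ : ℝ} (h0 : 0 < θ) :
    ‖Complex.exp (θ * Complex.I) - 1‖ ≤ θ := by
  have h := Real.norm_exp_I_mul_ofReal_sub_one_le (x := θ)
  rwa [mul_comm, Real.norm_of_nonneg h0.le] at h

lemma norm_integral_near_le {θ : ℝ} (h0 : 0 < θ) (h1 : θ ≤ 1) :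
    ‖∫ s in (0:ℝ)..θ, ((logWeight s / s : ℝ) : ℂ) *
      ((s : ℂ) / ((s : ℂ) + (Complex.exp (θ * Complex.I) - 1)))‖ ≤ 2 * logWeight θ := by
  have h := norm_integral_le_of_norm_le_const (a := 0) (b := θ) (C := 2 * logWeight θ / θ)
    (f := fun s : ℝ => ((logWeight s / s : ℝ) : ℂ) *
      ((s : ℂ) / ((s : ℂ) + (Complex.exp (θ * Complex.I) - 1)))) ?_
  · rwa [sub_zero, abs_of_pos h0, div_mul_cancel₀ _ h0.ne'] at h
  · intro s hs
    rw [Set.uIoc_of_le h0.le] at hs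
    have hk := logWeight_pos hs.1 (hs.2.trans h1)
    have hs0 := hs.1
    rw [norm_mul, norm_div, Complex.norm_real, Complex.norm_real, Real.norm_of_nonneg hs0.le,
      Real.norm_of_nonneg (by positivity)]
    calc logWeight s / s * (s / ‖(s : ℂ) + (Complex.exp (θ * Complex.I) - 1)‖)
        = logWeight s / ‖(s : ℂ) + (Complex.exp (θ * Complex.I) - 1)‖ := by field_simp
      _ ≤ logWeight θ / (θ / 2) := by
        gcongr
        · exact (logWeight_pos h0 h1).le
        · exact logWeight_mono hs0 hs.2 h1
        · exact half_le_norm_add_exp_sub_one s h0 h1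
      _ = 2 * logWeight θ / θ := by field_simp

lemma norm_integral_far_le {θ : ℝ} (h0 : 0 < θ) (h1 : θ ≤ 1) :
    ‖∫ s in θ..1, ((logWeight s / s : ℝ) : ℂ) *
      ((s : ℂ) / ((s : ℂ) + (Complex.exp (θ * Complex.I) - 1)) - 1)‖ ≤ 864 * logWeight θ := by
  have hk := logWeight_pos h0 h1
  have h0' : (0:ℝ) ∉ Set.uIcc θ 1 := by
    rw [Set.uIcc_of_le h1]
    exact fun h => absurd h.1 (not_le.2 h0)
  have hint : ∫ s in θ..1, s ^ (-3 / 2 : ℝ) = 2 * (θ ^ (-1 / 2 : ℝ) - 1) := by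
    rw [integral_rpow (Or.inr ⟨by norm_num, h0'⟩)]
    norm_num
    ring
  have h := norm_integral_le_of_norm_le (μ := volume) (a := θ) (b := 1)
    (g := fun s => 432 * logWeight θ * θ ^ (1 / 2 : ℝ) * s ^ (-3 / 2 : ℝ))
    (f := fun s : ℝ => ((logWeight s / s : ℝ) : ℂ) *
      ((s : ℂ) / ((s : ℂ) + (Complex.exp (θ * Complex.I) - 1)) - 1)) h1 ?_ ?_
  · refine h.trans ?_
    rw [intervalIntegral.integral_const_mul, hint]
    have hmul : θ ^ (1 / 2 : ℝ) * θ ^ (-1 / 2 : ℝ) = 1 := by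
      rw [← Real.rpow_add h0]
      norm_num
    have hpos : 0 ≤ logWeight θ * θ ^ (1 / 2 : ℝ) := by positivity
    calc _ = 864 * logWeight θ * (θ ^ (1 / 2 : ℝ) * θ ^ (-1 / 2 : ℝ))
          - 864 * (logWeight θ * θ ^ (1 / 2 : ℝ)) := by ring
      _ ≤ _ := by rw [hmul]; linarith
  · refine Filter.Eventually.of_forall fun s hs => ?_
    have hs0 : 0 < s := h0.trans hs.1
    have hks := logWeight_pos hs0 hs.2
    have hd := half_le_norm_add_exp_sub_one_of_le h0 h1 hs.1.le
    have hne : (s : ℂ) + (Complex.exp (θ * Complex.I) - 1) ≠ 0 :=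
      norm_pos_iff.1 (lt_of_lt_of_le (by positivity) hd)
    have hrw : (s : ℂ) / ((s : ℂ) + (Complex.exp (θ * Complex.I) - 1)) - 1 =
        -((Complex.exp (θ * Complex.I) - 1) / ((s : ℂ) + (Complex.exp (θ * Complex.I) - 1))) := by
      rw [div_sub_one hne, ← neg_div]
      congr 1
      ring
    have hpow : 216 * logWeight θ * (s / θ) ^ (1 / 2 : ℝ) / s * (θ / (s / 2)) =
        432 * logWeight θ * θ ^ (1 / 2 : ℝ) * s ^ (-3 / 2 : ℝ) := by
      have e1 : θ = θ ^ (1 / 2 : ℝ) * θ ^ (1 / 2 : ℝ) := by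
        rw [← Real.rpow_add h0]
        norm_num
      have e2 : s ^ (-3 / 2 : ℝ) = s ^ (1 / 2 : ℝ) / s ^ 2 := by
        rw [← Real.rpow_natCast s 2, ← Real.rpow_sub hs0]
        norm_num
      rw [Real.div_rpow hs0.le h0.le, e2]
      have hp : 0 < θ ^ (1 / 2 : ℝ) := by positivity
      generalize θ ^ (1 / 2 : ℝ) = x at e1 hp
      rw [e1]
      field_simp
      ring
    rw [norm_mul, hrw, norm_neg, norm_div, Complex.norm_real, Real.norm_of_nonneg (by positivity)]
    rw [← hpow]
    gcongr
    · exact logWeight_le_mul_rpow h0 hs.1.le hs.2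
    · exact norm_exp_sub_one_le h0
  · exact (intervalIntegrable_rpow (Or.inr h0')).const_mul _

lemma intervalIntegrable_boundary_integrand {θ : ℝ} (h0 : 0 < θ) (h1 : θ ≤ 1) :
    IntervalIntegrable (fun s : ℝ => ((logWeight s / s : ℝ) : ℂ) *
      ((s : ℂ) / ((s : ℂ) + (Complex.exp (θ * Complex.I) - 1)) - 1)) volume 0 1 := by
  refine IntervalIntegrable.mul_continuousOn
    (intervalIntegrable_ofReal_logWeight_div zero_le_one le_rfl) (Continuous.continuousOn ?_)
  refine (Continuous.div (by fun_prop) (by fun_prop) fun s => ?_).sub continuous_const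
  exact norm_pos_iff.1 (lt_of_lt_of_le (by positivity) (half_le_norm_add_exp_sub_one s h0 h1))

lemma norm_integral_add_logPrimitive_le {θ : ℝ} (h0 : 0 < θ) (h1 : θ ≤ 1) :
    ‖(∫ s in (0:ℝ)..1, ((logWeight s / s : ℝ) : ℂ) *
        ((s : ℂ) / ((s : ℂ) + (Complex.exp (θ * Complex.I) - 1)) - 1)) +
      ((1 / (Real.log (1 - Real.log θ) + 2) : ℝ) : ℂ)‖ ≤ 866 * logWeight θ := by
  have hF := intervalIntegrable_boundary_integrand h0 h1
  have hθ : θ ∈ Set.uIcc (0:ℝ) 1 := by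
    rw [Set.uIcc_of_le zero_le_one]
    exact ⟨h0.le, h1⟩
  have hF1 := hF.mono_set (Set.uIcc_subset_uIcc_left hθ)
  have hF2 := hF.mono_set (Set.uIcc_subset_uIcc_right hθ)
  rw [← integral_add_adjacent_intervals hF1 hF2, ← integral_logWeight_div h0 h1,
    ← intervalIntegral.integral_ofReal, add_right_comm, ← intervalIntegral.integral_add hF1
      (intervalIntegrable_ofReal_logWeight_div h0.le h1)]
  refine (norm_add_le _ _).trans ?_
  have hnear := norm_integral_near_le h0 h1
  have hfar := norm_integral_far_le h0 h1
  simp only [mul_sub_one, sub_add_cancel] at hfar ⊢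
  linarith

lemma logWeight_le_of_lt_exp_neg_one {θ : ℝ} (h0 : 0 < θ) (h1 : θ < Real.exp (-1)) :
    logWeight θ ≤ 1 / (|Real.log θ| * (Real.log (-Real.log θ)) ^ 2) := by
  have hl : Real.log θ < -1 := by
    have := Real.log_lt_log h0 h1
    rwa [Real.log_exp] at this
  have hp : 0 < Real.log (-Real.log θ) := Real.log_pos (by linarith)
  have hle : Real.log (-Real.log θ) ≤ Real.log (1 - Real.log θ) :=
    Real.log_le_log (by linarith) (by linarith)
  have hq : 0 < -Real.log θ := by linarith
  rw [abs_of_neg (by linarith)]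
  unfold logWeight
  gcongr <;> linarith

/-- With `g(t) = 1/((1+t)(1-log(1+t))(log(1-log(1+t))+2)²)` on `(-1,0]`,
there exist `C > 0` and `δ ∈ (0,1)` such that for all `θ ∈ (0,δ)`:
`|∫_{-1}^0 g(t)((1+t)/(t+e^{iθ}) - 1) dt + 1/(log(1-log θ)+2)|
  ≤ C/(|log θ|·(log(-log θ))²)`. -/
theorem G_boundary_difference_estimate :
    ∃ C : ℝ, 0 < C ∧ ∃ δ : ℝ, δ ∈ Set.Ioo (0:ℝ) 1 ∧
      ∀ θ : ℝ, θ ∈ Set.Ioo 0 δ →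
        ‖(∫ t in (-1:ℝ)..0,
              ((1 / ((1 + t) * (1 - Real.log (1 + t)) *
                  (Real.log (1 - Real.log (1 + t)) + 2) ^ 2) : ℝ) : ℂ) *
                (((1 + t : ℝ) : ℂ) / ((t : ℂ) + Complex.exp ((θ : ℂ) * Complex.I)) - 1)) +
            ((1 / (Real.log (1 - Real.log θ) + 2) : ℝ) : ℂ)‖ ≤
          C / (|Real.log θ| * (Real.log (-Real.log θ)) ^ 2) := by
  refine ⟨866, by norm_num, Real.exp (-1), ⟨Real.exp_pos _, Real.exp_lt_one_iff.2 (by norm_num)⟩, ?_⟩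
  rintro θ ⟨h0, h1⟩
  have hθ : θ ≤ 1 := (h1.trans (Real.exp_lt_one_iff.2 (by norm_num))).le
  have hsub := integral_comp_add_left (a := -1) (b := 0)
    (fun s : ℝ => ((logWeight s / s : ℝ) : ℂ) *
      ((s : ℂ) / ((s : ℂ) + (Complex.exp (θ * Complex.I) - 1)) - 1)) 1
  rw [add_neg_cancel, add_zero] at hsub
  have h := norm_integral_add_logPrimitive_le h0 hθ
  rw [← hsub] at h
  refine le_trans (le_of_eq ?_) (h.trans ?_)
  · congr 2
    refine integral_congr fun t _ => ?_
    have e1 : logWeight (1 + t) / (1 + t) = 1 / ((1 + t) * (1 - Real.log (1 + t)) *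
        (Real.log (1 - Real.log (1 + t)) + 2) ^ 2) := by
      rw [logWeight, div_div]
      congr 1
      ring
    have e2 : ((1 + t : ℝ) : ℂ) + (Complex.exp (θ * Complex.I) - 1) =
        t + Complex.exp (θ * Complex.I) := by
      push_cast
      ring
    simp only [e1, e2]
  · have := logWeight_le_of_lt_exp_neg_one h0 h1
    rw [← mul_one_div]
    gcongr
end
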